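/- arXiv:math/9911037 — 2 statements merged into one kernel-verified Lean document; each statement's English description precedes it below -/
import Mathlib

section
/- There exists a separable Banach space Z which is 2-β but for which there is no equivalent norm making Z 2-NUC; in particular, Z is not isomorphic to any 2-NUC Banach space. -/
open scoped BigOperators

/-- A node of the dyadic tree `T = ⋃ₙ {0,1}ⁿ`, modelled as a finite list of booleans.
The tree order `φ ≤ ψ` is the prefix order `φ <+: ψ`; the length of a node is its
list length. -/
abbrev Node : Type := List Bool

/-- The subtree `T_φ` consisting of all nodes `ψ` with `φ ≤ ψ`. -/
def Tsub (φ : Node) : Set Node := {ψ | φ <+: ψ}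

/-- `S_φ`: the set of nodes extending `φ` by zeroes (`false`s) only. -/
def Sset (φ : Node) : Set Node := {ψ | ∃ k : ℕ, ψ = φ ++ List.replicate k false}

/-- Two nodes are incomparable if neither is a prefix of the other. -/
def Incomparable (φ ψ : Node) : Prop := ¬ φ <+: ψ ∧ ¬ ψ <+: φ

/-- A finite set `A ⊆ T` is admissible if there is `n` such that every element of `A`
lies in some subtree `T_σ` with `|σ| = n`, and each such subtree contains at most one
element of `A`. -/
def Admissible (A : Finset Node) : Prop :=
  ∃ n : ℕ,
    (∀ φ ∈ A, ∃ σ : Node, σ.length = n ∧ σ <+: φ) ∧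
    (∀ σ : Node, σ.length = n → ∀ φ ∈ A, ∀ ψ ∈ A, σ <+: φ → σ <+: ψ → φ = ψ)

/-- A finite set `A ⊆ T` is acceptable if there is `n` such that every element of `A`
lies in some set `S_σ` with `|σ| = n`, and each such set contains at most one
element of `A`. -/
def Acceptable (A : Finset Node) : Prop :=
  ∃ n : ℕ,
    (∀ φ ∈ A, ∃ σ : Node, σ.length = n ∧ φ ∈ Sset σ) ∧
    (∀ σ : Node, σ.length = n → ∀ φ ∈ A, ∀ ψ ∈ A, φ ∈ Sset σ → ψ ∈ Sset σ → φ = ψ)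

/-- `Before A B` is the relation `A ≪ B`: every node of `A` is strictly shorter than
every node of `B`. -/
def Before (A B : Finset Node) : Prop :=
  ∀ φ ∈ A, ∀ ψ ∈ B, φ.length < ψ.length

/-- The norm `‖·‖_X` on `c₀₀(T)` (finitely supported functions on the tree, modelled
as `Node →₀ ℝ`): the supremum of `(∑ᵢ (∑_{φ ∈ Aᵢ} |x φ|)²)^{1/2}` over all finite
chains `A₁ ≪ ⋯ ≪ A_k` of admissible sets. -/
noncomputable def normX (x : Node →₀ ℝ) : ℝ :=
  sSup { r : ℝ | ∃ (k : ℕ) (A : Fin k → Finset Node),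
    (∀ i, Admissible (A i)) ∧ (∀ i j : Fin k, i < j → Before (A i) (A j)) ∧
    r = Real.sqrt (∑ i, (∑ φ ∈ A i, |x φ|) ^ 2) }

/-- The norm `‖·‖_Y` on `c₀₀(T)`: as `normX` but with acceptable sets. -/
noncomputable def normY (x : Node →₀ ℝ) : ℝ :=
  sSup { r : ℝ | ∃ (k : ℕ) (A : Fin k → Finset Node),
    (∀ i, Acceptable (A i)) ∧ (∀ i j : Fin k, i < j → Before (A i) (A j)) ∧
    r = Real.sqrt (∑ i, (∑ φ ∈ A i, |x φ|) ^ 2) }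

/-- The characteristic function `χ_A` of a finite set of nodes, as an element of
`c₀₀(T)`. -/
noncomputable def chi (A : Finset Node) : Node →₀ ℝ :=
  Finsupp.indicator A fun _ _ => (1 : ℝ)

open Classical in
/-- The sup norm `‖y·χ_S‖_∞` of the restriction of `y` to a set `S` of nodes. -/
noncomputable def supOn (y : Node →₀ ℝ) (S : Set Node) : ℝ :=
  sSup (Set.range fun ψ : Node => if ψ ∈ S then |y ψ| else 0)

/-- A branch of the dyadic tree, identified with an infinite 0-1 sequence. -/
abbrev Branch : Type := ℕ → Bool

/-- The node of length `n` on the branch `γ`. -/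
def branchNode (γ : Branch) (n : ℕ) : Node := List.ofFn fun i : Fin n => γ i

/-- A branch `γ` passes through the node `φ` iff `φ ∈ γ`. -/
def PassesThrough (γ : Branch) (φ : Node) : Prop := branchNode γ φ.length = φ

/-- A sequence is `ε`-separated: `inf {‖x_n - x_m‖ : m ≠ n} ≥ ε`. -/
def Separated {Z : Type*} [SeminormedAddGroup Z] (ε : ℝ) (x : ℕ → Z) : Prop :=
  ∀ m n : ℕ, m ≠ n → ε ≤ ‖x m - x n‖

/-- `ε`-separation with respect to a norm function `N`. -/
def SeparatedWith {Z : Type*} [AddGroup Z] (N : Z → ℝ) (ε : ℝ) (x : ℕ → Z) : Prop :=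
  ∀ m n : ℕ, m ≠ n → ε ≤ N (x m - x n)

/-- `N` is a norm on the real vector space `Z`. -/
def IsNormF {Z : Type*} [AddCommGroup Z] [Module ℝ Z] (N : Z → ℝ) : Prop :=
  (∀ x y : Z, N (x + y) ≤ N x + N y) ∧
  (∀ (a : ℝ) (x : Z), N (a • x) = |a| * N x) ∧
  (∀ x : Z, N x = 0 → x = 0)

/-- The `2`-NUC property with respect to a norm function `N`. -/
def TwoNUCWith {Z : Type*} [AddCommGroup Z] (N : Z → ℝ) : Prop :=
  ∀ ε : ℝ, 0 < ε → ∃ δ : ℝ, 0 < δ ∧ δ < 1 ∧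
    ∀ u : ℕ → Z, (∀ n, N (u n) ≤ 1) → SeparatedWith N ε u →
      ∃ n₁ n₂ : ℕ, n₁ < n₂ ∧ N (u n₁ + u n₂) / 2 ≤ 1 - δ

/-- The `1`-β property with respect to a norm function `N`. -/
def OneBetaWith {Z : Type*} [AddCommGroup Z] (N : Z → ℝ) : Prop :=
  ∀ ε : ℝ, 0 < ε → ∃ δ : ℝ, 0 < δ ∧ δ < 1 ∧
    ∀ x : Z, N x ≤ 1 → ∀ u : ℕ → Z, (∀ n, N (u n) ≤ 1) → SeparatedWith N ε u →
      ∃ n : ℕ, N (x + u n) / 2 ≤ 1 - δ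

/-- The property `k`-β of a Banach space. -/
def kBeta (k : ℕ) (Z : Type*) [NormedAddCommGroup Z] : Prop :=
  ∀ ε : ℝ, 0 < ε → ∃ δ : ℝ, 0 < δ ∧ δ < 1 ∧
    ∀ x : Z, ‖x‖ ≤ 1 → ∀ u : ℕ → Z, (∀ n, ‖u n‖ ≤ 1) → Separated ε u →
      ∃ ι : Fin k → ℕ, StrictMono ι ∧ ‖x + ∑ i, u (ι i)‖ / ((k : ℝ) + 1) ≤ 1 - δ

/-- The property `k`-NUC of a Banach space. -/
def kNUC (k : ℕ) (Z : Type*) [NormedAddCommGroup Z] : Prop :=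
  ∀ ε : ℝ, 0 < ε → ∃ δ : ℝ, 0 < δ ∧ δ < 1 ∧
    ∀ u : ℕ → Z, (∀ n, ‖u n‖ ≤ 1) → Separated ε u →
      ∃ ι : Fin k → ℕ, StrictMono ι ∧ ‖∑ i, u (ι i)‖ / (k : ℝ) ≤ 1 - δ

/-- Nearly uniform convexity. -/
def NUC (Z : Type*) [NormedAddCommGroup Z] [NormedSpace ℝ Z] : Prop :=
  ∀ ε : ℝ, 0 < ε → ∃ δ : ℝ, δ < 1 ∧
    ∀ u : ℕ → Z, (∀ n, ‖u n‖ ≤ 1) → Separated ε u →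
      ∃ y ∈ convexHull ℝ (Set.range u), ‖y‖ ≤ δ

namespace ResidueSpace

open Finset Filter Topology

/-- A finite set of natural numbers is spread if, for some `n`, its elements are at least `n`
and pairwise incongruent modulo `2 ^ n`. -/
def Spread (A : Finset ℕ) : Prop :=
  ∃ n : ℕ, (∀ i ∈ A, n ≤ i) ∧ ∀ i ∈ A, ∀ j ∈ A, i ≡ j [MOD 2 ^ n] → i = j

/-- Every element of `A` is smaller than every element of `B`. -/
def Precedes (A B : Finset ℕ) : Prop := ∀ a ∈ A, ∀ b ∈ B, a < b

/-- A finite family of successive spread sets. -/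
def SpreadChain (𝒜 : Finset (Finset ℕ)) : Prop :=
  (∀ A ∈ 𝒜, Spread A) ∧ ∀ A ∈ 𝒜, ∀ B ∈ 𝒜, A ≠ B → Precedes A B ∨ Precedes B A

/-- The sum of the absolute values of `y` over `A`. -/
def mass (A : Finset ℕ) (y : ℕ → ℝ) : ℝ := ∑ i ∈ A, |y i|

/-- The square sum of the masses of `y` over the members of `𝒜`. -/
def energy (𝒜 : Finset (Finset ℕ)) (y : ℕ → ℝ) : ℝ := ∑ A ∈ 𝒜, mass A y ^ 2

lemma Spread.mono {A B : Finset ℕ} (hB : Spread B) (h : A ⊆ B) : Spread A := by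
  obtain ⟨n, h1, h2⟩ := hB
  exact ⟨n, fun i hi => h1 i (h hi), fun i hi j hj => h2 i (h hi) j (h hj)⟩

lemma spread_empty : Spread ∅ := ⟨0, by simp, by simp⟩

lemma spread_singleton (i : ℕ) : Spread {i} := ⟨0, by simp, by simp⟩

lemma spreadChain_singleton {A : Finset ℕ} (hA : Spread A) : SpreadChain {A} := by
  refine ⟨by simpa using hA, ?_⟩
  intro B hB C hC h
  simp only [mem_singleton] at hB hC
  exact absurd (hB.trans hC.symm) h

lemma spreadChain_empty : SpreadChain ∅ := ⟨by simp, by simp⟩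

lemma SpreadChain.mono {𝒜 ℬ : Finset (Finset ℕ)} (h : SpreadChain ℬ) (hs : 𝒜 ⊆ ℬ) :
    SpreadChain 𝒜 :=
  ⟨fun A hA => h.1 A (hs hA), fun A hA B hB => h.2 A (hs hA) B (hs hB)⟩

@[simp] lemma energy_singleton (A : Finset ℕ) (y : ℕ → ℝ) : energy {A} y = mass A y ^ 2 := by
  simp [energy]

lemma mass_nonneg (A : Finset ℕ) (y : ℕ → ℝ) : 0 ≤ mass A y :=
  sum_nonneg fun _ _ => abs_nonneg _

lemma energy_nonneg (𝒜 : Finset (Finset ℕ)) (y : ℕ → ℝ) : 0 ≤ energy 𝒜 y :=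
  sum_nonneg fun _ _ => sq_nonneg _

lemma mass_mono {A B : Finset ℕ} (h : A ⊆ B) (y : ℕ → ℝ) : mass A y ≤ mass B y :=
  sum_le_sum_of_subset_of_nonneg h fun _ _ _ => abs_nonneg _

lemma mass_add_le (A : Finset ℕ) (y z : ℕ → ℝ) : mass A (y + z) ≤ mass A y + mass A z := by
  unfold mass
  rw [← sum_add_distrib]
  exact sum_le_sum fun i _ => abs_add_le _ _

lemma mass_smul (A : Finset ℕ) (c : ℝ) (y : ℕ → ℝ) : mass A (c • y) = |c| * mass A y := by
  simp [mass, abs_mul, mul_sum]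

lemma mass_eq_zero {A : Finset ℕ} {y : ℕ → ℝ} (h : ∀ i ∈ A, y i = 0) : mass A y = 0 :=
  sum_eq_zero fun i hi => by simp [h i hi]

lemma energy_eq_zero {𝒜 : Finset (Finset ℕ)} {y : ℕ → ℝ} (h : ∀ A ∈ 𝒜, ∀ i ∈ A, y i = 0) :
    energy 𝒜 y = 0 :=
  sum_eq_zero fun A hA => by simp [mass_eq_zero (h A hA)]

lemma energy_smul (𝒜 : Finset (Finset ℕ)) (c : ℝ) (y : ℕ → ℝ) :
    energy 𝒜 (c • y) = c ^ 2 * energy 𝒜 y := by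
  simp [energy, mass_smul, mul_pow, mul_sum]

lemma sqrt_energy_smul (𝒜 : Finset (Finset ℕ)) (c : ℝ) (y : ℕ → ℝ) :
    √(energy 𝒜 (c • y)) = |c| * √(energy 𝒜 y) := by
  rw [energy_smul, Real.sqrt_mul (sq_nonneg c), Real.sqrt_sq_eq_abs]

lemma sqrt_energy_add_le (𝒜 : Finset (Finset ℕ)) (y z : ℕ → ℝ) :
    √(energy 𝒜 (y + z)) ≤ √(energy 𝒜 y) + √(energy 𝒜 z) := by
  have hy := energy_nonneg 𝒜 y
  have hz := energy_nonneg 𝒜 z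
  rw [Real.sqrt_le_left (by positivity)]
  have hc : ∑ A ∈ 𝒜, mass A y * mass A z ≤ √(energy 𝒜 y) * √(energy 𝒜 z) := by
    rw [← Real.sqrt_mul hy]
    exact Real.le_sqrt_of_sq_le (sum_mul_sq_le_sq_mul_sq 𝒜 _ _)
  have h1 : energy 𝒜 (y + z) ≤ ∑ A ∈ 𝒜, (mass A y + mass A z) ^ 2 :=
    sum_le_sum fun A _ => pow_le_pow_left₀ (mass_nonneg _ _) (mass_add_le A y z) 2
  have h2 : ∑ A ∈ 𝒜, (mass A y + mass A z) ^ 2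
      = energy 𝒜 y + 2 * (∑ A ∈ 𝒜, mass A y * mass A z) + energy 𝒜 z := by
    simp only [energy, mul_sum, ← sum_add_distrib]
    exact sum_congr rfl fun A _ => by ring
  nlinarith [Real.sq_sqrt hy, Real.sq_sqrt hz]

lemma SpreadChain.union {𝒜 ℬ : Finset (Finset ℕ)} (h𝒜 : SpreadChain 𝒜) (hℬ : SpreadChain ℬ)
    (h : ∀ A ∈ 𝒜, ∀ B ∈ ℬ, Precedes A B) : SpreadChain (𝒜 ∪ ℬ) := by
  constructor
  · intro A hA
    rcases mem_union.1 hA with hA | hA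
    exacts [h𝒜.1 A hA, hℬ.1 A hA]
  · intro A hA B hB hne
    rcases mem_union.1 hA with hA | hA <;> rcases mem_union.1 hB with hB | hB
    exacts [h𝒜.2 A hA B hB hne, Or.inl (h A hA B hB), Or.inr (h B hB A hA), hℬ.2 A hA B hB hne]

lemma energy_union {𝒜 ℬ : Finset (Finset ℕ)} (h : ∀ A ∈ 𝒜, ∀ B ∈ ℬ, Precedes A B)
    (y : ℕ → ℝ) : energy (𝒜 ∪ ℬ) y = energy 𝒜 y + energy ℬ y := by
  unfold energy
  rw [← sum_union_inter, left_eq_add]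
  refine sum_eq_zero fun A hA => ?_
  have hA' := mem_inter.1 hA
  rw [mass_eq_zero fun i hi => absurd (h A hA'.1 A hA'.2 i hi i hi) (lt_irrefl i)]
  simp

/-- A chain splits at a level `L` into the members below `L`, at most one member meeting both
sides of `L`, and the members above `L`. -/
lemma SpreadChain.split {𝒜 : Finset (Finset ℕ)} (h : SpreadChain 𝒜) (L : ℕ) :
    ∃ (lo hi : Finset (Finset ℕ)) (M : Finset ℕ), SpreadChain lo ∧ Spread M ∧
      (∀ A ∈ lo, ∀ a ∈ A, a < L) ∧ (∀ A ∈ hi, ∀ a ∈ A, L ≤ a) ∧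
      (∀ A ∈ lo, Precedes A M) ∧ (M = ∅ ∨ ∃ a ∈ M, a < L) ∧
      ∀ y, energy 𝒜 y = energy lo y + mass M y ^ 2 + energy hi y := by
  classical
  set lo := 𝒜.filter fun A => ∀ a ∈ A, a < L with hlo
  set up := 𝒜.filter fun A => ¬ ∀ a ∈ A, a < L with hup
  set hi := up.filter fun A => ∀ a ∈ A, L ≤ a with hhi
  set mid := up.filter fun A => ¬ ∀ a ∈ A, L ≤ a with hmid
  have hsum : ∀ y, energy 𝒜 y = energy lo y + (energy hi y + energy mid y) := by
    intro y
    simp only [energy, hlo, hhi, hmid, hup, sum_filter_add_sum_filter_not]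
  have hmid1 : ∀ A, A ∈ mid ↔ A ∈ 𝒜 ∧ (∃ a ∈ A, L ≤ a) ∧ ∃ a ∈ A, a < L := by
    intro A
    simp [hmid, hup, and_assoc]
  have hlo1 : ∀ A ∈ lo, A ∈ 𝒜 ∧ ∀ a ∈ A, a < L := fun A hA => by simpa [hlo] using hA
  have hloc : SpreadChain lo := h.mono (filter_subset _ _)
  have hhi1 : ∀ A ∈ hi, ∀ a ∈ A, L ≤ a := fun A hA => (mem_filter.1 hA).2
  rcases mid.eq_empty_or_nonempty with hm | ⟨M, hM⟩
  · refine ⟨lo, hi, ∅, hloc, spread_empty, fun A hA => (hlo1 A hA).2, hhi1, ?_, Or.inl rfl, ?_⟩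
    · intro A _ a _ b hb
      simp at hb
    · intro y
      rw [hsum, hm]
      simp [energy, mass]
  · obtain ⟨hM1, ⟨b, hb, hbL⟩, ⟨a, ha, haL⟩⟩ := (hmid1 M).1 hM
    have hmid2 : mid = {M} := by
      refine eq_singleton_iff_unique_mem.2 ⟨hM, fun B hB => ?_⟩
      obtain ⟨hB1, ⟨b', hb', hbL'⟩, ⟨a', ha', haL'⟩⟩ := (hmid1 B).1 hB
      by_contra hne
      rcases h.2 B hB1 M hM1 hne with hp | hp
      · have := hp b' hb' a ha
        omega
      · have := hp b hb a' ha'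
        omega
    refine ⟨lo, hi, M, hloc, h.1 M hM1, fun A hA => (hlo1 A hA).2, hhi1, ?_,
      Or.inr ⟨a, ha, haL⟩, ?_⟩
    · intro A hA
      have hA1 := hlo1 A hA
      have hne : A ≠ M := by
        rintro rfl
        exact absurd (hA1.2 b hb) (not_lt.2 hbL)
      rcases h.2 A hA1.1 M hM1 hne with hp | hp
      · exact hp
      · intro c hc
        have h1 := hp b hb c hc
        have h2 := hA1.2 c hc
        omega
    · intro y
      rw [hsum, hmid2, energy_singleton]
      ring

lemma energy_le_sq {𝒜 : Finset (Finset ℕ)} (h : SpreadChain 𝒜) {y : ℕ → ℝ} {s : Finset ℕ}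
    (hs : ∀ i ∉ s, y i = 0) : energy 𝒜 y ≤ mass s y ^ 2 := by
  classical
  have h1 : energy 𝒜 y ≤ (∑ A ∈ 𝒜, mass A y) ^ 2 :=
    sum_sq_le_sq_sum_of_nonneg fun A _ => mass_nonneg A y
  have h2 : ∑ A ∈ 𝒜, mass A y ≤ mass s y := by
    have h3 : ∀ A ∈ 𝒜, mass A y = ∑ i ∈ A ∩ s, |y i| := by
      intro A _
      refine (sum_subset inter_subset_left fun i hi hi' => ?_).symm
      rw [hs i (fun his => hi' (mem_inter.2 ⟨hi, his⟩)), abs_zero]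
    rw [sum_congr rfl h3, ← sum_biUnion]
    · refine mass_mono (fun i hi => ?_) y
      obtain ⟨A, _, hA⟩ := mem_biUnion.1 hi
      exact (mem_inter.1 hA).2
    · intro A hA B hB hne
      rw [Function.onFun, disjoint_left]
      intro i hi hi'
      rcases h.2 A hA B hB hne with hp | hp
      · exact lt_irrefl i (hp i (mem_inter.1 hi).1 i (mem_inter.1 hi').1)
      · exact lt_irrefl i (hp i (mem_inter.1 hi').1 i (mem_inter.1 hi).1)
  exact h1.trans (pow_le_pow_left₀ (sum_nonneg fun A _ => mass_nonneg A y) h2 2)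

/-- The finitely supported real sequences, to be normed by spread chains. -/
def C00 : Type := ℕ →₀ ℝ

noncomputable instance : AddCommGroup C00 := inferInstanceAs (AddCommGroup (ℕ →₀ ℝ))

noncomputable instance : Module ℝ C00 := inferInstanceAs (Module ℝ (ℕ →₀ ℝ))

/-- The coordinates of a finitely supported sequence. -/
def C00.coord (x : C00) : ℕ → ℝ := fun i => (show ℕ →₀ ℝ from x) i

/-- The unit vectors. -/
noncomputable def C00.unit (i : ℕ) : C00 := (Finsupp.single i (1 : ℝ) : ℕ →₀ ℝ)

/-- Truncation to the coordinates at or beyond `K`. -/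
noncomputable def C00.tail (K : ℕ) (x : C00) : C00 :=
  Finsupp.filter (fun i => K ≤ i) (show ℕ →₀ ℝ from x)

namespace C00

@[simp] lemma coord_zero : (0 : C00).coord = 0 := rfl

@[simp] lemma coord_add (x y : C00) : (x + y).coord = x.coord + y.coord := rfl

@[simp] lemma coord_sub (x y : C00) : (x - y).coord = x.coord - y.coord := rfl

@[simp] lemma coord_smul (c : ℝ) (x : C00) : (c • x).coord = c • x.coord := rfl

lemma coord_sum {ι : Type*} (s : Finset ι) (f : ι → C00) :
    (∑ t ∈ s, f t).coord = ∑ t ∈ s, (f t).coord := by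
  classical
  induction s using Finset.induction_on with
  | empty => simp
  | insert a s ha ih => simp [sum_insert ha, ih]

lemma coord_unit (i j : ℕ) : (unit i).coord j = if i = j then 1 else 0 := by
  change (Finsupp.single i (1 : ℝ) : ℕ →₀ ℝ) j = _
  rw [Finsupp.single_apply]

lemma coord_tail (K : ℕ) (x : C00) (i : ℕ) :
    (x.tail K).coord i = if K ≤ i then x.coord i else 0 :=
  Finsupp.filter_apply _ _ _

lemma ext_coord {x y : C00} (h : ∀ i, x.coord i = y.coord i) : x = y := Finsupp.ext h

lemma exists_bound (x : C00) : ∃ L, ∀ i, L ≤ i → x.coord i = 0 := by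
  obtain ⟨L, hL⟩ := (show ℕ →₀ ℝ from x).support.bddAbove
  refine ⟨L + 1, fun i hi => ?_⟩
  by_contra h
  have := hL (Finsupp.mem_support_iff.2 h)
  omega

noncomputable instance : Norm C00 :=
  ⟨fun x => ⨆ 𝒜 : {𝒜 : Finset (Finset ℕ) // SpreadChain 𝒜}, √(energy 𝒜.1 x.coord)⟩

lemma sqrt_energy_le_mass {𝒜 : Finset (Finset ℕ)} (h : SpreadChain 𝒜) {x : C00} {s : Finset ℕ}
    (hs : ∀ i ∉ s, x.coord i = 0) : √(energy 𝒜 x.coord) ≤ mass s x.coord :=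
  Real.sqrt_le_iff.2 ⟨mass_nonneg _ _, energy_le_sq h hs⟩

lemma norm_le_mass {x : C00} {s : Finset ℕ} (hs : ∀ i ∉ s, x.coord i = 0) :
    ‖x‖ ≤ mass s x.coord :=
  have : Nonempty {𝒜 : Finset (Finset ℕ) // SpreadChain 𝒜} := ⟨⟨∅, spreadChain_empty⟩⟩
  ciSup_le fun 𝒜 => sqrt_energy_le_mass 𝒜.2 hs

lemma sqrt_energy_le_norm {𝒜 : Finset (Finset ℕ)} (h : SpreadChain 𝒜) (x : C00) :
    √(energy 𝒜 x.coord) ≤ ‖x‖ := by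
  obtain ⟨L, hL⟩ := x.exists_bound
  refine le_ciSup (f := fun 𝒜 : {𝒜 : Finset (Finset ℕ) // SpreadChain 𝒜} =>
    √(energy 𝒜.1 x.coord)) ⟨mass (range L) x.coord, ?_⟩ ⟨𝒜, h⟩
  rintro _ ⟨ℬ, rfl⟩
  exact sqrt_energy_le_mass ℬ.2 fun i hi => hL i (by simpa using hi)

lemma exists_lt_sqrt_energy {x : C00} {r : ℝ} (hr : r < ‖x‖) :
    ∃ 𝒜, SpreadChain 𝒜 ∧ r < √(energy 𝒜 x.coord) := by
  have : Nonempty {𝒜 : Finset (Finset ℕ) // SpreadChain 𝒜} := ⟨⟨∅, spreadChain_empty⟩⟩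
  obtain ⟨𝒜, h⟩ := exists_lt_of_lt_ciSup hr
  exact ⟨𝒜.1, 𝒜.2, h⟩

lemma mass_le_norm {A : Finset ℕ} (hA : Spread A) (x : C00) : mass A x.coord ≤ ‖x‖ := by
  have := sqrt_energy_le_norm (spreadChain_singleton hA) x
  rwa [energy_singleton, Real.sqrt_sq (mass_nonneg _ _)] at this

lemma abs_coord_le_norm (x : C00) (i : ℕ) : |x.coord i| ≤ ‖x‖ := by
  simpa [mass] using mass_le_norm (spread_singleton i) x

lemma normedSpaceCore : NormedSpace.Core ℝ C00 where
  norm_nonneg x := (abs_nonneg _).trans (x.abs_coord_le_norm 0)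
  norm_smul c x := by
    change (⨆ 𝒜 : {𝒜 : Finset (Finset ℕ) // SpreadChain 𝒜}, √(energy 𝒜.1 (c • x).coord)) = _
    simp only [coord_smul, sqrt_energy_smul]
    exact (Real.mul_iSup_of_nonneg (abs_nonneg c) _).symm
  norm_triangle x y := by
    have : Nonempty {𝒜 : Finset (Finset ℕ) // SpreadChain 𝒜} := ⟨⟨∅, spreadChain_empty⟩⟩
    refine ciSup_le fun 𝒜 => ?_
    rw [coord_add]
    exact (sqrt_energy_add_le _ _ _).trans
      (add_le_add (sqrt_energy_le_norm 𝒜.2 x) (sqrt_energy_le_norm 𝒜.2 y))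
  norm_eq_zero_iff x := by
    constructor
    · intro h
      refine ext_coord fun i => ?_
      have := x.abs_coord_le_norm i
      rw [h] at this
      exact abs_eq_zero.1 (le_antisymm this (abs_nonneg _))
    · rintro rfl
      refine le_antisymm ?_ ((abs_nonneg _).trans (abs_coord_le_norm 0 0))
      simpa [mass] using norm_le_mass (x := 0) (s := ∅) (by simp)

noncomputable instance : NormedAddCommGroup C00 := NormedAddCommGroup.ofCore normedSpaceCore

noncomputable instance : NormedSpace ℝ C00 := NormedSpace.ofCore normedSpaceCore

lemma energy_le_norm_sq {𝒜 : Finset (Finset ℕ)} (h : SpreadChain 𝒜) (x : C00) :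
    energy 𝒜 x.coord ≤ ‖x‖ ^ 2 := by
  have := pow_le_pow_left₀ (Real.sqrt_nonneg _) (sqrt_energy_le_norm h x) 2
  rwa [Real.sq_sqrt (energy_nonneg _ _)] at this

lemma norm_unit_le (i : ℕ) : ‖unit i‖ ≤ 1 := by
  refine (norm_le_mass (s := {i}) fun j hj => ?_).trans ?_
  · rw [coord_unit, if_neg fun h => hj (by simp [h])]
  · simp [mass, coord_unit]

instance : TopologicalSpace.SeparableSpace C00 := by
  have h : TopologicalSpace.IsSeparable (Submodule.span ℝ (Set.range unit) : Set C00) :=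
    (Set.countable_range unit).isSeparable.span
  have htop : (Submodule.span ℝ (Set.range unit) : Set C00) = Set.univ := by
    rw [← Submodule.top_coe (R := ℝ)]
    congr 1
    refine eq_top_iff.2 fun x _ => ?_
    refine Finsupp.induction_linear (motive := fun x : ℕ →₀ ℝ =>
      (show C00 from x) ∈ Submodule.span ℝ (Set.range unit)) x (Submodule.zero_mem _)
      (fun x y hx hy => Submodule.add_mem _ hx hy) fun i c => ?_
    have : (show C00 from (Finsupp.single i c : ℕ →₀ ℝ)) = c • unit i := by
      refine ext_coord fun j => ?_
      rw [coord_smul, Pi.smul_apply, coord_unit]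
      change (Finsupp.single i c : ℕ →₀ ℝ) j = _
      rw [Finsupp.single_apply]
      simp
    rw [this]
    exact Submodule.smul_mem _ _ (Submodule.subset_span ⟨i, rfl⟩)
  rw [htop] at h
  exact TopologicalSpace.isSeparable_univ_iff.1 h

end C00

lemma exists_subseq_tendsto {ι : Type*} [Countable ι] (v : ℕ → ι → ℝ) (hv : ∀ n i, |v n i| ≤ 1) :
    ∃ (w : ι → ℝ) (φ : ℕ → ℕ), StrictMono φ ∧
      ∀ i, Tendsto (fun n => v (φ n) i) atTop (𝓝 (w i)) := by
  have hc : IsCompact (Set.pi Set.univ fun _ : ι => Set.Icc (-1 : ℝ) 1) :=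
    isCompact_univ_pi fun _ => isCompact_Icc
  obtain ⟨w, _, φ, hφ, hw⟩ := hc.tendsto_subseq (x := v) fun n i _ => abs_le.1 (hv n i)
  exact ⟨w, φ, hφ, fun i => (tendsto_pi_nhds.1 hw) i⟩

lemma tendsto_energy {v : ℕ → ℕ → ℝ} {w : ℕ → ℝ}
    (h : ∀ i, Tendsto (fun n => v n i) atTop (𝓝 (w i))) (𝒜 : Finset (Finset ℕ)) :
    Tendsto (fun n => energy 𝒜 (v n)) atTop (𝓝 (energy 𝒜 w)) :=
  tendsto_finsetSum _ fun _ _ => (tendsto_finsetSum _ fun i _ => (h i).abs).pow 2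

/-- If all energies are bounded by `1`, then spread sets far out have small mass. -/
lemma exists_mass_le_of_energy_le {w : ℕ → ℝ} (hw : ∀ 𝒜, SpreadChain 𝒜 → energy 𝒜 w ≤ 1)
    {κ : ℝ} (hκ : 0 < κ) (L : ℕ) :
    ∃ K, L ≤ K ∧ ∀ D, Spread D → (∀ i ∈ D, K ≤ i) → mass D w ≤ κ := by
  classical
  have : Nonempty {𝒜 : Finset (Finset ℕ) // SpreadChain 𝒜} := ⟨⟨∅, spreadChain_empty⟩⟩
  have hbdd : BddAbove (Set.range fun 𝒜 : {𝒜 : Finset (Finset ℕ) // SpreadChain 𝒜} =>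
      energy 𝒜.1 w) := ⟨1, by rintro _ ⟨𝒜, rfl⟩; exact hw _ 𝒜.2⟩
  obtain ⟨⟨𝒜, h𝒜⟩, h⟩ := exists_lt_of_lt_ciSup (f := fun 𝒜 : {𝒜 : Finset (Finset ℕ) //
    SpreadChain 𝒜} => energy 𝒜.1 w) (sub_lt_self _ (sq_pos_of_pos hκ))
  obtain ⟨K, hK⟩ := (𝒜.biUnion id).bddAbove
  refine ⟨max L (K + 1), le_max_left _ _, fun D hD hDK => ?_⟩
  have hp : ∀ A ∈ 𝒜, ∀ B ∈ ({D} : Finset (Finset ℕ)), Precedes A B := by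
    intro A hA B hB a ha b hb
    rw [mem_singleton.1 hB] at hb
    have h1 : a ≤ K := hK (mem_coe.2 (mem_biUnion.2 ⟨A, hA, ha⟩))
    have h2 := hDK b hb
    omega
  have h1 := le_ciSup hbdd ⟨_, h𝒜.union (spreadChain_singleton hD) hp⟩
  simp only [energy_union hp, energy_singleton] at h1
  dsimp only at h
  exact le_of_sq_le_sq (by linarith) hκ.le

/-- Quantitative uniform convexity for three vectors in `ℝ³`. -/
lemma near_max_of_three {a₁ a₂ b₁ b₂ b₃ c₁ c₂ c₃ δ : ℝ} (hδ : 0 ≤ δ)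
    (ha : a₁ ^ 2 + a₂ ^ 2 ≤ 1) (hb : b₁ ^ 2 + b₂ ^ 2 + b₃ ^ 2 ≤ 1)
    (hc : c₁ ^ 2 + c₂ ^ 2 + c₃ ^ 2 ≤ 1)
    (h : 9 * (1 - δ) ^ 2 ≤ (a₁ + b₁ + c₁) ^ 2 + (a₂ + b₂ + c₂) ^ 2 + (b₃ + c₃) ^ 2) :
    1 - 24 * δ ≤ b₁ ^ 2 + b₂ ^ 2 ∧ (b₂ - c₂) ^ 2 ≤ 18 * δ := by
  have h1 : (a₁ - b₁) ^ 2 + (a₂ - b₂) ^ 2 + b₃ ^ 2 + (b₁ - c₁) ^ 2 + (b₂ - c₂) ^ 2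
      + (b₃ - c₃) ^ 2 + (a₁ - c₁) ^ 2 + (a₂ - c₂) ^ 2 + c₃ ^ 2 ≤ 18 * δ
        - 3 * (1 - b₁ ^ 2 - b₂ ^ 2 - b₃ ^ 2) := by
    nlinarith [sq_nonneg δ]
  constructor
  · nlinarith [sq_nonneg (a₁ - b₁), sq_nonneg (a₂ - b₂), sq_nonneg (b₁ - c₁), sq_nonneg (b₂ - c₂),
      sq_nonneg (b₃ - c₃), sq_nonneg (a₁ - c₁), sq_nonneg (a₂ - c₂), sq_nonneg c₃]
  · nlinarith [sq_nonneg (a₁ - b₁), sq_nonneg (a₂ - b₂), sq_nonneg (b₁ - c₁), sq_nonneg b₃,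
      sq_nonneg (b₃ - c₃), sq_nonneg (a₁ - c₁), sq_nonneg (a₂ - c₂), sq_nonneg c₃]

lemma mass_le_filter_add (A : Finset ℕ) (y : ℕ → ℝ) (K : ℕ) :
    mass A y = mass (A.filter (· < K)) y + mass (A.filter (K ≤ ·)) y := by
  simp only [mass, ← not_lt]
  exact (sum_filter_add_sum_filter_not _ _ _).symm

lemma abs_mass_sub_le (A : Finset ℕ) (y z : ℕ → ℝ) :
    |mass A y - mass A z| ≤ mass A (y - z) := by
  simp only [mass, ← sum_sub_distrib]
  exact (abs_sum_le_sum_abs _ _).trans (sum_le_sum fun i _ => abs_abs_sub_abs_le _ _)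

/-- The far elements of a spread set can be moved within their residue classes. -/
lemma Spread.exists_exchange {M : Finset ℕ} (hM : Spread M) {L K K' : ℕ}
    (hL : ∃ a ∈ M, a < L) (hLK : L ≤ K) (hK : K ≤ K') {u v : ℕ → ℝ} {η : ℝ} (hη : 0 ≤ η)
    (hu : ∀ i, K' ≤ i → u i = 0)
    (hstar : ∀ i, K ≤ i → ∃ j, K ≤ j ∧ j ≡ i [MOD 2 ^ L] ∧ |v i| ≤ |u j| + η) :
    ∃ A, Spread A ∧ (∀ j ∈ A, j ∈ M ∨ K ≤ j) ∧
      mass M u + mass (M.filter (K' ≤ ·)) v - 2 ^ L * η ≤ mass A u := by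
  classical
  obtain ⟨n, hn, hinc⟩ := hM
  obtain ⟨a, ha, haL⟩ := hL
  have hnL : n ≤ L := (hn a ha).trans haL.le
  choose! f hf1 hf2 hf3 using hstar
  set D := M.filter (K' ≤ ·) with hD
  have hDK : ∀ i ∈ D, i ∈ M ∧ K ≤ i := fun i hi =>
    ⟨(mem_filter.1 hi).1, hK.trans (mem_filter.1 hi).2⟩
  have hfn : ∀ i ∈ D, f i ≡ i [MOD 2 ^ n] := fun i hi =>
    (hf2 i (hDK i hi).2).of_dvd (pow_dvd_pow 2 hnL)
  have hinj : Set.InjOn f D := by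
    intro i hi j hj hij
    refine hinc i (hDK i hi).1 j (hDK j hj).1 ((hfn i hi).symm.trans ?_)
    rw [hij]
    exact hfn j hj
  have hdisj : Disjoint (M.filter (· < K')) (D.image f) := by
    rw [disjoint_left]
    intro i hi hi'
    obtain ⟨j, hj, rfl⟩ := mem_image.1 hi'
    have hi1 := mem_filter.1 hi
    have := hinc _ hi1.1 j (hDK j hj).1 (hfn j hj)
    have h2 := (mem_filter.1 hj).2
    omega
  have hcard : (D.card : ℝ) ≤ 2 ^ L := by
    have : D.card ≤ (range (2 ^ n)).card := by
      refine card_le_card_of_injOn (· % 2 ^ n) (fun i _ => ?_) fun i hi j hj hij => ?_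
      · exact mem_coe.2 (mem_range.2 (Nat.mod_lt _ (by positivity)))
      · exact hinc i (hDK i hi).1 j (hDK j hj).1 hij
    rw [card_range] at this
    exact_mod_cast this.trans (Nat.pow_le_pow_right (by norm_num) hnL)
  have hrep : ∀ i ∈ M.filter (· < K') ∪ D.image f, n ≤ i ∧ ∃ m ∈ M, i ≡ m [MOD 2 ^ n] ∧
      ((m < K' ∧ i = m) ∨ (m ∈ D ∧ i = f m)) := by
    intro i hi
    rcases mem_union.1 hi with hi | hi
    · have := mem_filter.1 hi
      exact ⟨hn i this.1, i, this.1, rfl, Or.inl ⟨this.2, rfl⟩⟩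
    · obtain ⟨j, hj, rfl⟩ := mem_image.1 hi
      exact ⟨(hnL.trans hLK).trans (hf1 j (hDK j hj).2), j, (hDK j hj).1, hfn j hj,
        Or.inr ⟨hj, rfl⟩⟩
  refine ⟨M.filter (· < K') ∪ D.image f, ⟨n, fun i hi => (hrep i hi).1, ?_⟩, ?_, ?_⟩
  · intro i hi j hj hij
    obtain ⟨_, m, hm, him, h1⟩ := hrep i hi
    obtain ⟨_, m', hm', hjm, h2⟩ := hrep j hj
    have hmm : m = m' := hinc m hm m' hm' ((him.symm.trans hij).trans hjm)
    subst hmm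
    rcases h1 with h1 | h1 <;> rcases h2 with h2 | h2
    · rw [h1.2, h2.2]
    · exact absurd h1.1 (not_lt.2 (mem_filter.1 h2.1).2)
    · exact absurd h2.1 (not_lt.2 (mem_filter.1 h1.1).2)
    · rw [h1.2, h2.2]
  · intro j hj
    rcases mem_union.1 hj with hj | hj
    · exact Or.inl (mem_filter.1 hj).1
    · obtain ⟨i, hi, rfl⟩ := mem_image.1 hj
      exact Or.inr (hf1 i (hDK i hi).2)
  · have h1 : mass (M.filter (· < K') ∪ D.image f) u
        = mass (M.filter (· < K')) u + ∑ i ∈ D, |u (f i)| := by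
      unfold mass
      rw [sum_union hdisj, sum_image hinj]
    have h2 : mass D v ≤ ∑ i ∈ D, |u (f i)| + D.card * η := by
      rw [← nsmul_eq_mul, ← sum_const, ← sum_add_distrib]
      exact sum_le_sum fun i hi => hf3 i (hDK i hi).2
    have h3 : mass D u = 0 := mass_eq_zero fun i hi => hu i (mem_filter.1 hi).2
    have h4 := mass_le_filter_add M u K'
    have h5 := mul_le_mul_of_nonneg_right hcard hη
    rw [h1]
    linarith

/-- The supremum of `|y|` over the elements at or beyond `K` of a residue class. -/
noncomputable def residueSup (L K r : ℕ) (y : ℕ → ℝ) : ℝ :=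
  ⨆ i, if K ≤ i ∧ i ≡ r [MOD 2 ^ L] then |y i| else 0

lemma abs_residueSup_le {y : ℕ → ℝ} (hy : ∀ i, |y i| ≤ 1) (L K r : ℕ) :
    |residueSup L K r y| ≤ 1 := by
  have h : ∀ i, (if K ≤ i ∧ i ≡ r [MOD 2 ^ L] then |y i| else 0) ≤ 1 := fun i => by
    split_ifs
    exacts [hy i, zero_le_one]
  rw [residueSup, abs_of_nonneg (Real.iSup_nonneg fun i => by positivity)]
  exact ciSup_le h

lemma exists_le_of_residueSup_close {u v : ℕ → ℝ} (hv : ∀ i, |v i| ≤ 1) {L K : ℕ} {η : ℝ}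
    (hη : 0 < η) (h : ∀ r < 2 ^ L, residueSup L K r v ≤ residueSup L K r u + η)
    (i : ℕ) (hi : K ≤ i) : ∃ j, K ≤ j ∧ j ≡ i [MOD 2 ^ L] ∧ |v i| ≤ |u j| + 2 * η := by
  have hr := h (i % 2 ^ L) (Nat.mod_lt _ (by positivity))
  have hbdd : BddAbove (Set.range fun j =>
      if K ≤ j ∧ j ≡ i % 2 ^ L [MOD 2 ^ L] then |v j| else 0) := by
    refine ⟨1, ?_⟩
    rintro _ ⟨j, rfl⟩
    dsimp only
    split_ifs
    exacts [hv j, zero_le_one]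
  have h1 : |v i| ≤ residueSup L K (i % 2 ^ L) v := by
    have := le_ciSup hbdd i
    rwa [if_pos ⟨hi, (Nat.mod_modEq i _).symm⟩] at this
  obtain ⟨j, hj⟩ := exists_lt_of_lt_ciSup (sub_lt_self (residueSup L K (i % 2 ^ L) u) hη)
  split_ifs at hj with hc
  · exact ⟨j, hc.1, hc.2.trans (Nat.mod_modEq i _), by linarith⟩
  · exact ⟨i, hi, rfl, by linarith [abs_nonneg (u i)]⟩

lemma SpreadChain.exists_tail {𝒜 : Finset (Finset ℕ)} (h : SpreadChain 𝒜) (K : ℕ) (y : ℕ → ℝ) :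
    ∃ ℬ, SpreadChain ℬ ∧ (∀ A ∈ ℬ, ∀ a ∈ A, K ≤ a) ∧
      energy 𝒜 (fun i => if K ≤ i then y i else 0) = energy ℬ y := by
  classical
  set 𝒜' := 𝒜.filter fun A => ∃ a ∈ A, K ≤ a with h𝒜'
  have hinj : Set.InjOn (fun A : Finset ℕ => A.filter (K ≤ ·)) 𝒜' := by
    intro A hA B hB hAB
    obtain ⟨hA1, a, ha, haK⟩ := mem_filter.1 hA
    have hB1 := (mem_filter.1 hB).1
    by_contra hne
    have haB : a ∈ B := by
      have : a ∈ A.filter (K ≤ ·) := mem_filter.2 ⟨ha, haK⟩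
      dsimp only at hAB
      rw [hAB] at this
      exact (mem_filter.1 this).1
    rcases h.2 A hA1 B hB1 hne with hp | hp
    · exact lt_irrefl a (hp a ha a haB)
    · exact lt_irrefl a (hp a haB a ha)
  refine ⟨𝒜'.image fun A => A.filter (K ≤ ·), ⟨?_, ?_⟩, ?_, ?_⟩
  · intro A hA
    obtain ⟨B, hB, rfl⟩ := mem_image.1 hA
    exact (h.1 B (mem_filter.1 hB).1).mono (filter_subset _ _)
  · intro A hA A' hA' hne
    obtain ⟨B, hB, rfl⟩ := mem_image.1 hA
    obtain ⟨B', hB', rfl⟩ := mem_image.1 hA'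
    refine (h.2 B (mem_filter.1 hB).1 B' (mem_filter.1 hB').1 ?_).imp ?_ ?_
    · rintro rfl
      exact hne rfl
    · exact fun hp a ha b hb => hp a (mem_filter.1 ha).1 b (mem_filter.1 hb).1
    · exact fun hp a ha b hb => hp a (mem_filter.1 ha).1 b (mem_filter.1 hb).1
  · intro A hA a ha
    obtain ⟨B, hB, rfl⟩ := mem_image.1 hA
    exact (mem_filter.1 ha).2
  · have hmass : ∀ A : Finset ℕ, mass A (fun i => if K ≤ i then y i else 0)
        = mass (A.filter (K ≤ ·)) y := by
      intro A
      rw [mass, mass, sum_filter]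
      exact sum_congr rfl fun i _ => by split_ifs <;> simp
    rw [energy, energy, sum_image hinj, h𝒜', sum_filter]
    refine sum_congr rfl fun A _ => ?_
    rw [hmass]
    split_ifs with hc
    · rfl
    · rw [mass_eq_zero fun i hi => absurd ⟨i, mem_filter.1 hi⟩ hc]
      simp

namespace C00

lemma norm_le_tail_add (K : ℕ) (x : C00) : ‖x‖ ≤ ‖x.tail K‖ + mass (range K) x.coord := by
  have h : ‖x - x.tail K‖ ≤ mass (range K) x.coord := by
    refine (norm_le_mass (s := range K) fun i hi => ?_).trans (sum_le_sum fun i hi => ?_)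
    · have : K ≤ i := by simpa using hi
      simp [coord_tail, this]
    · have : ¬ K ≤ i := by simpa using hi
      simp [coord_tail, this]
  calc ‖x‖ = ‖x.tail K + (x - x.tail K)‖ := by rw [add_sub_cancel]
    _ ≤ _ := (norm_add_le _ _).trans (by gcongr)

lemma energy_add_mass_sq_le {lo : Finset (Finset ℕ)} {A : Finset ℕ} (hlo : SpreadChain lo)
    (hA : Spread A) (h : ∀ B ∈ lo, Precedes B A) (x : C00) :
    energy lo x.coord + mass A x.coord ^ 2 ≤ ‖x‖ ^ 2 := by
  have hp : ∀ B ∈ lo, ∀ C ∈ ({A} : Finset (Finset ℕ)), Precedes B C := fun B hB C hC => by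
    rw [mem_singleton.1 hC]
    exact h B hB
  have := energy_le_norm_sq (hlo.union (spreadChain_singleton hA) hp) x
  rwa [energy_union hp, energy_singleton] at this

lemma energy_add_norm_tail_sq_le {lo : Finset (Finset ℕ)} {K : ℕ} (hlo : SpreadChain lo)
    (hK : ∀ A ∈ lo, ∀ a ∈ A, a < K) (x : C00) :
    energy lo x.coord + ‖x.tail K‖ ^ 2 ≤ ‖x‖ ^ 2 := by
  by_contra! hlt
  have h0 := energy_le_norm_sq hlo x
  obtain ⟨𝒜, h𝒜, h⟩ := exists_lt_sqrt_energy
    ((Real.sqrt_lt' (lt_of_le_of_ne (norm_nonneg (x.tail K)) (by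
      intro h
      rw [← h] at hlt
      linarith))).2 (show ‖x‖ ^ 2 - energy lo x.coord < ‖x.tail K‖ ^ 2 by linarith))
  obtain ⟨ℬ, hℬ, hℬK, he⟩ := h𝒜.exists_tail K x.coord
  have h1 := (Real.sqrt_lt_sqrt_iff (by linarith)).1 h
  have h2 : (x.tail K).coord = fun i => if K ≤ i then x.coord i else 0 :=
    funext fun i => coord_tail K x i
  rw [h2, he] at h1
  have hp : ∀ A ∈ lo, ∀ B ∈ ℬ, Precedes A B := fun A hA B hB a ha b hb =>
    (hK A hA a ha).trans_le (hℬK B hB b hb)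
  have h3 := energy_le_norm_sq (hlo.union hℬ hp) x
  rw [energy_union hp] at h3
  linarith

lemma norm_add_add_le {x u v : C00} {w : ℕ → ℝ} {L K K' : ℕ} {τ : ℝ} (hτ : 0 < τ) (hτ1 : τ ≤ 1)
    (hx : ‖x‖ ≤ 1) (hu : ‖u‖ ≤ 1) (hv : ‖v‖ ≤ 1) (hLK : L ≤ K) (hKK : K ≤ K')
    (hxL : ∀ i, L ≤ i → x.coord i = 0) (huK : ∀ i, K' ≤ i → u.coord i = 0)
    (htail : 3 * τ < ‖u.tail K‖ ^ 2)
    (hw : ∀ D, Spread D → (∀ i ∈ D, K ≤ i) → mass D w ≤ τ / 20)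
    (huw : mass (range K) (u.coord - w) ≤ τ / 20) (hvw : mass (range K') (v.coord - w) ≤ τ / 20)
    (hstar : ∀ i, K ≤ i → ∃ j, K ≤ j ∧ j ≡ i [MOD 2 ^ L] ∧
      |v.coord i| ≤ |u.coord j| + τ / (20 * 2 ^ L)) :
    ‖x + u + v‖ ≤ 3 * (1 - τ ^ 2 / 200) := by
  by_contra! hlt
  obtain ⟨𝒜, h𝒜, hen⟩ := exists_lt_sqrt_energy hlt
  obtain ⟨lo, hi, M, hlo, hM, hloL, hhiL, hloM, hMne, hsplit⟩ := h𝒜.split L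
  have hen0 : 0 ≤ 3 * (1 - τ ^ 2 / 200) := by nlinarith
  have hen1 : 9 * (1 - τ ^ 2 / 200) ^ 2 ≤ energy 𝒜 (x + u + v).coord := by
    have := (Real.lt_sqrt hen0).1 hen
    nlinarith
  have hsq : ∀ y, √(energy lo y) ^ 2 = energy lo y := fun y => Real.sq_sqrt (energy_nonneg _ _)
  have hsq' : ∀ y, √(energy hi y) ^ 2 = energy hi y := fun y => Real.sq_sqrt (energy_nonneg _ _)
  have hle : ∀ y : C00, ‖y‖ ≤ 1 → √(energy lo y.coord) ^ 2 + mass M y.coord ^ 2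
      + √(energy hi y.coord) ^ 2 ≤ 1 := by
    intro y hy
    rw [hsq, hsq', ← hsplit]
    exact (energy_le_norm_sq h𝒜 y).trans (pow_le_one₀ (norm_nonneg _) hy)
  have hxhi : energy hi x.coord = 0 := energy_eq_zero fun A hA i hi => hxL i (hhiL A hA i hi)
  have hx1 : √(energy lo x.coord) ^ 2 + mass M x.coord ^ 2 ≤ 1 := by
    have := hle x hx
    rwa [hxhi, Real.sqrt_zero, zero_pow two_ne_zero, add_zero] at this
  have hsum : 9 * (1 - τ ^ 2 / 200) ^ 2 ≤
      (√(energy lo x.coord) + √(energy lo u.coord) + √(energy lo v.coord)) ^ 2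
      + (mass M x.coord + mass M u.coord + mass M v.coord) ^ 2
      + (√(energy hi u.coord) + √(energy hi v.coord)) ^ 2 := by
    refine hen1.trans ?_
    rw [hsplit, ← hsq, ← hsq', coord_add, coord_add]
    gcongr
    · exact (sqrt_energy_add_le _ _ _).trans (by gcongr; exact sqrt_energy_add_le _ _ _)
    · exact mass_nonneg _ _
    · exact (mass_add_le _ _ _).trans (by gcongr; exact mass_add_le _ _ _)
    · refine (sqrt_energy_add_le _ _ _).trans (add_le_add ?_ le_rfl)
      refine (sqrt_energy_add_le _ _ _).trans ?_
      rw [hxhi, Real.sqrt_zero, zero_add]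
  obtain ⟨hb, hbc⟩ := near_max_of_three (by positivity) hx1 (hle u hu) (hle v hv) hsum
  rw [hsq] at hb
  have hbc' : mass M u.coord - mass M v.coord ≤ 3 / 10 * τ :=
    le_of_sq_le_sq (by nlinarith) (by positivity)
  have hu1 : ‖u‖ ^ 2 ≤ 1 := pow_le_one₀ (norm_nonneg _) hu
  have hMu : mass M u.coord ≤ 1 := (mass_le_norm hM u).trans hu
  have hsplitM := fun y => mass_le_filter_add M y K
  set B := M.filter (· < K) with hB
  set D := M.filter (K ≤ ·) with hD
  have hB0 := mass_nonneg B u.coord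
  have hD0 := mass_nonneg D u.coord
  have hBs : Spread B := hM.mono (filter_subset _ _)
  have hloK : ∀ A ∈ lo, ∀ a ∈ A, a < K := fun A hA a ha => (hloL A hA a ha).trans_le hLK
  have hu2 := hsplitM u.coord
  rcases le_or_gt (mass D u.coord) τ with hcase | hcase
  · have hp : ∀ A ∈ lo, ∀ C ∈ ({B} : Finset (Finset ℕ)), Precedes A C := by
      intro A hA C hC a ha b hb
      rw [mem_singleton.1 hC] at hb
      exact hloM A hA a ha b (mem_filter.1 hb).1
    have h1 := energy_add_norm_tail_sq_le (hlo.union (spreadChain_singleton hBs) hp) (K := K)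
      (by
        intro A hA a ha
        rcases mem_union.1 hA with hA | hA
        · exact hloK A hA a ha
        · rw [mem_singleton.1 hA] at ha
          exact (mem_filter.1 ha).2) u
    rw [energy_union hp, energy_singleton] at h1
    have h2 : mass M u.coord ^ 2 ≤ mass B u.coord ^ 2 + 2 * τ := by
      rw [hu2] at hMu ⊢
      nlinarith
    linarith [mul_le_mul_of_nonneg_left hτ1 hτ.le, sq τ]
  · have hML : ∃ a ∈ M, a < L := by
      refine hMne.resolve_left fun h => ?_
      rw [hD, h] at hcase
      simp only [mass, filter_empty, sum_empty] at hcase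
      linarith
    obtain ⟨A, hA, hAM, hAu⟩ := hM.exists_exchange hML hLK hKK (by positivity) huK hstar
    have h1 := energy_add_mass_sq_le hlo hA (fun C hC c hc j hj => by
      rcases hAM j hj with h | h
      · exact hloM C hC c hc j h
      · exact (hloK C hC c hc).trans_le h) u
    have hη : (2 : ℝ) ^ L * (τ / (20 * 2 ^ L)) = τ / 20 := by
      field_simp
    rw [hη] at hAu
    have hsub : ∀ {E : Finset ℕ} {y : ℕ → ℝ} {k : ℕ}, (∀ i ∈ E, i < k) →
        mass (range k) (y - w) ≤ τ / 20 → |mass E y - mass E w| ≤ τ / 20 := fun hE hy =>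
      (abs_mass_sub_le _ _ _).trans ((mass_mono (fun i hi => mem_range.2 (hE i hi)) _).trans hy)
    have hBK : ∀ i ∈ B, i < K := fun i hi => (mem_filter.1 hi).2
    have h2 := abs_le.1 (hsub hBK huw)
    have h3 := abs_le.1 (hsub (fun i hi => (hBK i hi).trans_le hKK) hvw)
    have hv2 := hsplitM v.coord
    have hv3 := mass_le_filter_add D v.coord K'
    have h4 := abs_le.1 (hsub (E := D.filter (· < K')) (fun i hi => (mem_filter.1 hi).2) hvw)
    have h5 := hw (D.filter (· < K')) ((hM.mono (filter_subset _ _)).mono (filter_subset _ _))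
      fun i hi => (mem_filter.1 (mem_filter.1 hi).1).2
    have h6 : mass (D.filter (K' ≤ ·)) v.coord ≤ mass (M.filter (K' ≤ ·)) v.coord :=
      mass_mono (filter_subset_filter _ (filter_subset _ _)) _
    have h7 : mass M u.coord + 9 / 20 * τ ≤ mass A u.coord := by linarith
    have h8 : mass M u.coord ^ 2 + (9 / 20 * τ) ^ 2 ≤ mass A u.coord ^ 2 := by
      have h9 := pow_le_pow_left₀ (add_nonneg (mass_nonneg M u.coord) (by positivity)) h7 2
      linarith [mul_nonneg (mass_nonneg M u.coord) hτ.le, add_sq (mass M u.coord) (9 / 20 * τ)]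
    linarith [mul_pow (9 / 20) τ 2, sq_pos_of_pos hτ]

/-- The finitely supported sequences have property `2`-β. -/
theorem two_beta {ε : ℝ} (hε : 0 < ε) : ∃ δ : ℝ, 0 < δ ∧ δ < 1 ∧
    ∀ x : C00, ‖x‖ ≤ 1 → ∀ u : ℕ → C00, (∀ n, ‖u n‖ ≤ 1) →
      (∀ m n, m ≠ n → ε ≤ ‖u m - u n‖) →
      ∃ n₁ n₂ : ℕ, n₁ < n₂ ∧ ‖x + u n₁ + u n₂‖ ≤ 3 * (1 - δ) := by
  wlog hε1 : ε ≤ 1 generalizing ε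
  · obtain ⟨δ, h1, h2, h3⟩ := this one_pos le_rfl
    exact ⟨δ, h1, h2, fun x hx u hu hs => h3 x hx u hu fun m n hmn =>
      (not_le.1 hε1).le.trans (hs m n hmn)⟩
  obtain ⟨τ, hτ⟩ : ∃ τ, τ = ε ^ 2 / 40 := ⟨_, rfl⟩
  have hτ0 : 0 < τ := by rw [hτ]; positivity
  have hτ1 : τ ≤ ε / 40 := by nlinarith
  refine ⟨τ ^ 2 / 200, by positivity, by nlinarith, fun x hx u hu hs => ?_⟩
  obtain ⟨L, hL⟩ := x.exists_bound
  have hu1 : ∀ n i, |(u n).coord i| ≤ 1 := fun n i => (abs_coord_le_norm _ i).trans (hu n)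
  obtain ⟨w, φ, hφ, hw⟩ := exists_subseq_tendsto (ι := ℕ ⊕ ℕ × ℕ)
    (fun n => Sum.elim (u n).coord fun p => residueSup L p.1 p.2 (u n).coord) (by
      rintro n (i | p)
      exacts [hu1 n i, abs_residueSup_le (hu1 n) _ _ _])
  have hw1 : ∀ i, Tendsto (fun n => (u (φ n)).coord i) atTop (𝓝 (w (Sum.inl i))) :=
    fun i => hw (Sum.inl i)
  set y : ℕ → ℝ := fun i => w (Sum.inl i) with hy
  obtain ⟨K, hLK, hK⟩ := exists_mass_le_of_energy_le (w := y)
    (fun 𝒜 h𝒜 => le_of_tendsto' (tendsto_energy hw1 𝒜) fun n =>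
      (energy_le_norm_sq h𝒜 _).trans (pow_le_one₀ (norm_nonneg _) (hu _)))
    (show 0 < τ / 20 by positivity) L
  have hclose : ∀ k, ∀ᶠ n in atTop, mass (range k) ((u (φ n)).coord - y) ≤ τ / 20 := by
    intro k
    have h1 : Tendsto (fun n => mass (range k) ((u (φ n)).coord - y)) atTop (𝓝 0) := by
      have : Tendsto (fun n => mass (range k) ((u (φ n)).coord - y)) atTop
          (𝓝 (∑ i ∈ range k, |y i - y i|)) :=
        tendsto_finsetSum _ fun i _ => ((hw1 i).sub_const _).abs
      simpa using this
    exact (h1.eventually_lt_const (show 0 < τ / 20 by positivity)).mono fun n hn => hn.le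
  obtain ⟨η, hη⟩ : ∃ η, η = τ / (20 * 2 ^ L) := ⟨_, rfl⟩
  have hη0 : 0 < η := by rw [hη]; positivity
  have hres : ∀ᶠ n in atTop, ∀ r ∈ range (2 ^ L),
      |residueSup L K r (u (φ n)).coord - w (Sum.inr (K, r))| < η / 4 := by
    rw [eventually_all_finset]
    intro r _
    have := (hw (Sum.inr (K, r))).sub_const (w (Sum.inr (K, r)))
    rw [sub_self] at this
    refine this.abs.eventually_lt_const ?_
    rw [abs_zero]
    positivity
  obtain ⟨n₀, hn₀⟩ := eventually_atTop.1 ((hclose K).and hres)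
  obtain ⟨p, hp0, hp⟩ : ∃ p, n₀ ≤ p ∧ ε / 3 < ‖(u (φ p)).tail K‖ := by
    by_contra! hcon
    have h1 := hcon n₀ le_rfl
    have h2 := hcon (n₀ + 1) (by omega)
    have h3 := hs (φ n₀) (φ (n₀ + 1)) (hφ.injective.ne (by omega))
    have h4 := norm_le_tail_add K (u (φ n₀) - u (φ (n₀ + 1)))
    have h5 : (u (φ n₀) - u (φ (n₀ + 1))).tail K
        = (u (φ n₀)).tail K - (u (φ (n₀ + 1))).tail K := by
      refine ext_coord fun i => ?_
      simp only [coord_tail, coord_sub, Pi.sub_apply]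
      split_ifs <;> simp
    have h6 : mass (range K) (u (φ n₀) - u (φ (n₀ + 1))).coord ≤ τ / 20 + τ / 20 := by
      refine le_trans ?_ (add_le_add (hn₀ n₀ le_rfl).1 (hn₀ (n₀ + 1) (by omega)).1)
      rw [mass, mass, mass, ← sum_add_distrib]
      refine sum_le_sum fun i _ => ?_
      simp only [coord_sub, Pi.sub_apply]
      rw [abs_sub_comm ((u (φ (n₀ + 1))).coord i)]
      exact abs_sub_le _ _ _
    rw [h5] at h4
    have h7 := norm_sub_le ((u (φ n₀)).tail K) ((u (φ (n₀ + 1))).tail K)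
    linarith
  obtain ⟨K₁, hK₁⟩ := (u (φ p)).exists_bound
  obtain ⟨q, hq0, hq⟩ := ((eventually_gt_atTop p).and (hclose (max K K₁))).exists
  refine ⟨φ p, φ q, hφ hq0, ?_⟩
  refine norm_add_add_le (w := y) hτ0 (by linarith) hx (hu _) (hu _) hLK (le_max_left K K₁) hL
    (fun i hi => hK₁ i ((le_max_right _ _).trans hi)) ?_ hK (hn₀ p hp0).1 hq ?_
  · nlinarith
  · rw [← hη, show η = 2 * (η / 2) by ring]
    refine exists_le_of_residueSup_close (hu1 _) (by positivity) fun r hr => ?_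
    have h1 := abs_lt.1 ((hn₀ p hp0).2 r (mem_range.2 hr))
    have h2 := abs_lt.1 ((hn₀ q (hp0.trans hq0.le)).2 r (mem_range.2 hr))
    linarith

end C00

namespace C00

/-- The sum of the unit vectors with indices given by `W`. -/
noncomputable def unitSum {ι : Type} [Fintype ι] (W : ι → ℕ) : C00 := ∑ t, unit (W t)

lemma coord_unitSum {ι : Type} [Fintype ι] (W : ι → ℕ) (j : ℕ) :
    (unitSum W).coord j = ∑ t, if W t = j then 1 else 0 := by
  rw [unitSum, coord_sum, Finset.sum_apply]
  exact sum_congr rfl fun t _ => coord_unit _ _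

lemma coord_unitSum_eq_zero {ι : Type} [Fintype ι] {W : ι → ℕ} {j : ℕ} (h : ∀ t, W t ≠ j) :
    (unitSum W).coord j = 0 := by
  rw [coord_unitSum]
  exact sum_eq_zero fun t _ => if_neg (h t)

lemma coord_unitSum_apply {ι : Type} [Fintype ι] {W : ι → ℕ} (hW : W.Injective) (t : ι) :
    (unitSum W).coord (W t) = 1 := by
  classical
  rw [coord_unitSum]
  simp [hW.eq_iff]

lemma card_le_norm {ι : Type} [Fintype ι] {W : ι → ℕ} {n : ℕ} (hn : ∀ t, n ≤ W t)
    (hW : ∀ t t', W t ≡ W t' [MOD 2 ^ n] → t = t') {x : C00} (hx : ∀ t, x.coord (W t) = 1) :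
    (Fintype.card ι : ℝ) ≤ ‖x‖ := by
  classical
  have hinj : Function.Injective W := fun t t' h => hW t t' (by rw [h])
  have hs : Spread (univ.image W) := by
    refine ⟨n, fun i hi => ?_, fun i hi j hj hij => ?_⟩
    · obtain ⟨t, _, rfl⟩ := mem_image.1 hi
      exact hn t
    · obtain ⟨t, _, rfl⟩ := mem_image.1 hi
      obtain ⟨t', _, rfl⟩ := mem_image.1 hj
      rw [hW t t' hij]
  refine le_trans (le_of_eq ?_) (mass_le_norm hs x)
  rw [mass, sum_image hinj.injOn]
  simp [hx]

/-- Every refinement of the family of residue classes `r` modulo `2 ^ n` contains indices whose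
unit vectors have a sum of `N`-size at most `M` times their number. -/
def SmallOn (N : C00 → ℝ) (M : ℝ) {ι : Type} [Fintype ι] (n : ℕ) (r : ι → ℕ) : Prop :=
  ∀ m, n ≤ m → ∀ s : ι → ℕ, (∀ t, s t ≡ r t [MOD 2 ^ n]) →
    ∃ W : ι → ℕ, (∀ t, W t ≡ s t [MOD 2 ^ m]) ∧ (∀ t, m ≤ W t) ∧
      N (unitSum W) ≤ M * Fintype.card ι

/-- The residues `r` are pairwise incongruent modulo `2 ^ n`. -/
def DistinctMod {ι : Type} (n : ℕ) (r : ι → ℕ) : Prop :=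
  ∀ t t', r t ≡ r t' [MOD 2 ^ n] → t = t'

lemma DistinctMod.congr {ι : Type} {n : ℕ} {r s : ι → ℕ} (h : DistinctMod n r)
    (hs : ∀ t, s t ≡ r t [MOD 2 ^ n]) : DistinctMod n s := fun t t' ht =>
  h t t' (((hs t).symm.trans ht).trans (hs t'))

lemma not_add_two_pow_modEq (a m : ℕ) : ¬ a + 2 ^ m ≡ a [MOD 2 ^ (m + 1)] := by
  intro h
  have h1 : 2 ^ m ≡ 0 [MOD 2 ^ (m + 1)] := Nat.ModEq.add_left_cancel' a (by simpa using h)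
  have h2 := Nat.le_of_dvd (by positivity) ((Nat.modEq_zero_iff_dvd).1 h1)
  have h3 : 0 < 2 ^ m := by positivity
  rw [pow_succ] at h2
  omega

lemma add_two_pow_modEq (a : ℕ) {n m : ℕ} (h : n ≤ m) : a + 2 ^ m ≡ a [MOD 2 ^ n] := by
  have := (Nat.modEq_zero_iff_dvd.2 (pow_dvd_pow 2 h)).add_left a
  simpa using this

lemma SmallOn.exists_smaller {N : C00 → ℝ} (hN : IsNormF N) {c C δ M : ℝ} (hc : 0 < c)
    (hcN : ∀ x, c * ‖x‖ ≤ N x) (hδ : ∀ u : ℕ → C00, (∀ n, N (u n) ≤ 1) →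
      SeparatedWith N (c / C) u → ∃ n₁ n₂ : ℕ, n₁ < n₂ ∧ N (u n₁ + u n₂) / 2 ≤ 1 - δ)
    (hM : 0 < M) (hMC : M ≤ C) {ι : Type} [Fintype ι] [Nonempty ι] {n : ℕ} {r : ι → ℕ}
    (hr : DistinctMod n r) (hP : SmallOn N M n r) :
    ∃ (n' : ℕ) (r' : ι ⊕ ι → ℕ), DistinctMod n' r' ∧ SmallOn N ((1 - δ) * M) n' r' := by
  by_contra! hcon
  have hcard : (0 : ℝ) < Fintype.card ι := by exact_mod_cast Fintype.card_pos
  have hstep : ∀ p : {p : ℕ × (ι → ℕ) // n ≤ p.1 ∧ ∀ t, p.2 t ≡ r t [MOD 2 ^ n]},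
      ∃ (q : {p : ℕ × (ι → ℕ) // n ≤ p.1 ∧ ∀ t, p.2 t ≡ r t [MOD 2 ^ n]}) (W : ι → ℕ),
        p.1.1 + 1 ≤ q.1.1 ∧ (∀ t, q.1.2 t ≡ p.1.2 t [MOD 2 ^ (p.1.1 + 1)]) ∧
        (∀ t, W t ≡ p.1.2 t + 2 ^ p.1.1 [MOD 2 ^ (p.1.1 + 1)]) ∧ (∀ t, p.1.1 ≤ W t) ∧
        N (unitSum W) ≤ M * Fintype.card ι ∧
        ∀ V : ι → ℕ, (∀ t, V t ≡ q.1.2 t [MOD 2 ^ q.1.1]) → (∀ t, q.1.1 ≤ V t) →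
          (1 - δ) * M * (2 * Fintype.card ι) < N (unitSum W + unitSum V) := by
    rintro ⟨⟨m, g⟩, hm, hg⟩
    dsimp only at hm hg
    have hdg := hr.congr hg
    have hnm : 2 ^ n ∣ 2 ^ (m + 1) := pow_dvd_pow 2 (by omega)
    have hmm : 2 ^ m ∣ 2 ^ (m + 1) := pow_dvd_pow 2 (by omega)
    have hd : DistinctMod (m + 1) (Sum.elim (fun t => g t + 2 ^ m) g) := by
      rintro (t | t) (t' | t') h
      · exact congrArg _ (hdg t t' ((Nat.ModEq.add_right_cancel' _ h).of_dvd hnm))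
      · have := hdg t t' ((add_two_pow_modEq (g t) hm).symm.trans (h.of_dvd hnm))
        subst this
        exact absurd h (not_add_two_pow_modEq _ _)
      · have := hdg t t' ((h.of_dvd hnm).trans (add_two_pow_modEq (g t') hm))
        subst this
        exact absurd h.symm (not_add_two_pow_modEq _ _)
      · exact congrArg _ (hdg t t' (h.of_dvd hnm))
    have hfail := hcon _ _ hd
    simp only [SmallOn] at hfail
    push Not at hfail
    obtain ⟨m', hm', s, hs, hbig⟩ := hfail
    have hsl : ∀ t, s (Sum.inl t) ≡ g t + 2 ^ m [MOD 2 ^ (m + 1)] := fun t => hs (Sum.inl t)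
    have hsr : ∀ t, s (Sum.inr t) ≡ g t [MOD 2 ^ (m + 1)] := fun t => hs (Sum.inr t)
    obtain ⟨W, hW1, hW2, hW3⟩ := hP m' (by omega) (fun t => s (Sum.inl t)) fun t =>
      (((hsl t).of_dvd hnm).trans (add_two_pow_modEq _ hm)).trans (hg t)
    refine ⟨⟨⟨m', fun t => s (Sum.inr t)⟩, by dsimp only; omega, fun t =>
      ((hsr t).of_dvd hnm).trans (hg t)⟩, W, hm', hsr, fun t =>
      ((hW1 t).of_dvd (pow_dvd_pow 2 hm')).trans (hsl t), fun t => ?_, hW3, fun V hV1 hV2 => ?_⟩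
    · exact ((Nat.le_succ m).trans hm').trans (hW2 t)
    · have h1 := hbig (Sum.elim W V) (by rintro (t | t); exacts [hW1 t, hV1 t])
        (by rintro (t | t); exacts [hW2 t, hV2 t])
      have h2 : unitSum (Sum.elim W V) = unitSum W + unitSum V := Fintype.sum_sum_type _
      rw [h2, Fintype.card_sum, Nat.cast_add, ← two_mul] at h1
      exact h1
  choose step W hnext1 hnext2 hW1 hW2 hW3 hW4 using hstep
  let st : ℕ → {p : ℕ × (ι → ℕ) // n ≤ p.1 ∧ ∀ t, p.2 t ≡ r t [MOD 2 ^ n]} :=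
    fun i => step^[i] ⟨⟨n, r⟩, le_rfl, fun _ => rfl⟩
  have hst : ∀ i, st (i + 1) = step (st i) := fun i => Function.iterate_succ_apply' _ _ _
  have hmono : ∀ i j, i ≤ j → (st i).1.1 ≤ (st j).1.1 ∧
      ∀ t, (st j).1.2 t ≡ (st i).1.2 t [MOD 2 ^ (st i).1.1] := by
    intro i j hij
    induction j, hij using Nat.le_induction with
    | base => exact ⟨le_rfl, fun _ => rfl⟩
    | succ j _ ih =>
      rw [hst]
      have h1 := hnext1 (st j)
      refine ⟨by omega, fun t => Nat.ModEq.trans ?_ (ih.2 t)⟩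
      exact (hnext2 (st j) t).of_dvd (pow_dvd_pow 2 (by omega))
  have hWst : ∀ j t, W (st j) t ≡ (st j).1.2 t [MOD 2 ^ (st j).1.1] := fun j t =>
    ((hW1 (st j) t).of_dvd (pow_dvd_pow 2 (by omega))).trans (add_two_pow_modEq _ le_rfl)
  have hWr : ∀ j t, W (st j) t ≡ r t [MOD 2 ^ n] := fun j t =>
    ((hWst j t).of_dvd (pow_dvd_pow 2 (st j).2.1)).trans ((st j).2.2 t)
  have hWn : ∀ j t, n ≤ W (st j) t := fun j t => (st j).2.1.trans (hW2 _ t)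
  have hWd : ∀ j, DistinctMod n (W (st j)) := fun j => hr.congr (hWr j)
  have hlt : ∀ i j, i < j → ∀ t t', W (st i) t ≠ W (st j) t' := by
    intro i j hij t t' h
    have h1 : t = t' := hr t t' (by
      have := hWr i t
      rw [h] at this
      exact this.symm.trans (hWr j t'))
    subst h1
    have h2 := hmono (i + 1) j hij
    rw [hst] at h2
    have h3 : W (st j) t ≡ (st i).1.2 t [MOD 2 ^ ((st i).1.1 + 1)] := by
      have h4 : 2 ^ ((st i).1.1 + 1) ∣ 2 ^ (step (st i)).1.1 := pow_dvd_pow 2 (hnext1 (st i))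
      exact (((hWst j t).of_dvd (pow_dvd_pow 2 ((hnext1 (st i)).trans h2.1))).trans
        ((h2.2 t).of_dvd h4)).trans (hnext2 (st i) t)
    rw [← h] at h3
    exact not_add_two_pow_modEq _ _ ((hW1 (st i) t).symm.trans h3)
  have hne : ∀ i j, i ≠ j → ∀ t t', W (st i) t ≠ W (st j) t' := fun i j hij t t' =>
    hij.lt_or_gt.elim (fun h => hlt i j h t t') fun h => (hlt j i h t' t).symm
  have hMcard : 0 < M * Fintype.card ι := mul_pos hM hcard
  have hsmul : ∀ x, N ((M * Fintype.card ι)⁻¹ • x) = (M * Fintype.card ι)⁻¹ * N x := fun x => by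
    rw [hN.2.1, abs_of_pos (inv_pos.2 hMcard)]
  obtain ⟨i, j, hij, hle⟩ := hδ (fun i => (M * Fintype.card ι)⁻¹ • unitSum (W (st i)))
    (fun i => by
      rw [hsmul, inv_mul_le_iff₀ hMcard, mul_one]
      exact hW3 _)
    (fun i j hij => by
      rw [← smul_sub, hsmul, ← div_eq_inv_mul, le_div_iff₀ hMcard]
      have h1 : (Fintype.card ι : ℝ) ≤ ‖unitSum (W (st i)) - unitSum (W (st j))‖ := by
        refine card_le_norm (hWn i) (hWd i) fun t => ?_
        rw [coord_sub, Pi.sub_apply, coord_unitSum_apply (fun t t' h => hWd i t t' (by rw [h])),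
          coord_unitSum_eq_zero fun t' => hne j i hij.symm t' t, sub_zero]
      calc c / C * (M * Fintype.card ι) = c * Fintype.card ι * (M / C) := by ring
        _ ≤ c * Fintype.card ι * 1 := by
          gcongr
          exact div_le_one_of_le₀ hMC (hM.le.trans hMC)
        _ ≤ c * ‖unitSum (W (st i)) - unitSum (W (st j))‖ := by
          rw [mul_one]
          gcongr
        _ ≤ _ := hcN _)
  have h1 := hmono (i + 1) j hij
  rw [hst] at h1
  have h2 := hW4 (st i) (W (st j)) (fun t =>
    ((hWst j t).of_dvd (pow_dvd_pow 2 h1.1)).trans (h1.2 t)) fun t => h1.1.trans (hW2 _ t)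
  rw [← smul_add, hsmul, div_le_iff₀ two_pos, inv_mul_le_iff₀ hMcard] at hle
  linarith

/-- No equivalent norm on the finitely supported sequences is `2`-NUC. -/
theorem not_twoNUCWith {N : C00 → ℝ} (hN : IsNormF N) {c C : ℝ} (hc : 0 < c) (hC : 0 < C)
    (hcC : ∀ x, c * ‖x‖ ≤ N x ∧ N x ≤ C * ‖x‖) : ¬ TwoNUCWith N := by
  intro h
  obtain ⟨δ, hδ0, hδ1, hδ⟩ := h (c / C) (div_pos hc hC)
  have hiter : ∀ k : ℕ, ∃ (ι : Type) (_ : Fintype ι) (_ : Nonempty ι) (n : ℕ) (r : ι → ℕ),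
      DistinctMod n r ∧ SmallOn N ((1 - δ) ^ k * C) n r := by
    intro k
    induction k with
    | zero =>
      refine ⟨Unit, inferInstance, inferInstance, 0, fun _ => 0, fun _ _ _ => rfl,
        fun m _ s _ => ⟨fun t => s t + 2 ^ m * m, fun t => ?_, fun t => ?_, ?_⟩⟩
      · exact (Nat.ModEq.refl (s t)).add (Nat.modEq_zero_iff_dvd.2 (dvd_mul_right _ _))
      · have : 1 * m ≤ 2 ^ m * m := Nat.mul_le_mul_right _ Nat.one_le_two_pow
        dsimp only
        omega
      · refine (hcC _).2.trans ?_
        simpa [unitSum] using mul_le_mul_of_nonneg_left (norm_unit_le (s () + 2 ^ m * m)) hC.le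
    | succ k ih =>
      obtain ⟨ι, _, _, n, r, hr, hP⟩ := ih
      have h1 : 0 < 1 - δ := sub_pos.2 hδ1
      obtain ⟨n', r', hr', hP'⟩ := hP.exists_smaller hN hc (fun x => (hcC x).1) hδ
        (mul_pos (pow_pos h1 k) hC)
        (mul_le_of_le_one_left hC.le (pow_le_one₀ h1.le (by linarith))) hr
      refine ⟨ι ⊕ ι, inferInstance, inferInstance, n', r', hr', ?_⟩
      rwa [pow_succ', mul_assoc]
  have hlow : ∀ k : ℕ, c ≤ (1 - δ) ^ k * C := by
    intro k
    obtain ⟨ι, _, _, n, r, hr, hP⟩ := hiter k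
    obtain ⟨W, hW1, hW2, hW3⟩ := hP n le_rfl r fun _ => rfl
    have hd := hr.congr hW1
    have h1 := card_le_norm hW2 hd (x := unitSum W) fun t =>
      coord_unitSum_apply (fun t t' h => hd t t' (by rw [h])) t
    have hcard : (0 : ℝ) < Fintype.card ι := by exact_mod_cast Fintype.card_pos
    refine le_of_mul_le_mul_right ?_ hcard
    exact (mul_le_mul_of_nonneg_left h1 hc.le).trans ((hcC _).1.trans hW3)
  have hlim : Tendsto (fun k : ℕ => (1 - δ) ^ k * C) atTop (𝓝 0) := by
    simpa using (tendsto_pow_atTop_nhds_zero_of_lt_one (sub_nonneg.2 hδ1.le)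
      (sub_lt_self 1 hδ0)).mul_const C
  exact absurd (ge_of_tendsto' hlim hlow) (not_le.2 hc)

lemma exists_coe_approx (x : UniformSpace.Completion C00) (hx : ‖x‖ ≤ 1) {θ : ℝ} (hθ : 0 < θ)
    (hθ1 : θ ≤ 1) : ∃ y : C00, ‖y‖ ≤ 1 ∧ ‖(y : UniformSpace.Completion C00) - x‖ ≤ 2 * θ := by
  obtain ⟨y, hy⟩ := (UniformSpace.Completion.denseRange_coe (α := C00)).exists_dist_lt
    ((1 - θ) • x) hθ
  rw [dist_comm, dist_eq_norm] at hy
  have h1 : ‖(1 - θ) • x‖ ≤ 1 - θ := by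
    rw [norm_smul, Real.norm_of_nonneg (by linarith)]
    exact mul_le_of_le_one_right (by linarith) hx
  refine ⟨y, ?_, ?_⟩
  · rw [← UniformSpace.Completion.norm_coe]
    linarith [norm_le_norm_add_norm_sub' (y : UniformSpace.Completion C00) ((1 - θ) • x)]
  · have h2 : (y : UniformSpace.Completion C00) - x = (y - (1 - θ) • x) - θ • x := by
      rw [sub_smul, one_smul]
      abel
    have h3 : ‖θ • x‖ ≤ θ := by
      rw [norm_smul, Real.norm_of_nonneg hθ.le]
      exact mul_le_of_le_one_right hθ.le hx
    rw [h2]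
    linarith [norm_sub_le ((y : UniformSpace.Completion C00) - (1 - θ) • x) (θ • x)]

/-- The completion of the finitely supported sequences has property `2`-β. -/
theorem completion_two_beta {ε : ℝ} (hε : 0 < ε) : ∃ δ : ℝ, 0 < δ ∧ δ < 1 ∧
    ∀ x : UniformSpace.Completion C00, ‖x‖ ≤ 1 → ∀ u : ℕ → UniformSpace.Completion C00,
      (∀ n, ‖u n‖ ≤ 1) → Separated ε u →
      ∃ n₁ n₂ : ℕ, n₁ < n₂ ∧ ‖x + u n₁ + u n₂‖ / 3 ≤ 1 - δ := by
  obtain ⟨δ, hδ0, hδ1, hδ⟩ := two_beta (half_pos hε)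
  refine ⟨δ / 2, by linarith, by linarith, fun x hx u hu hs => ?_⟩
  obtain ⟨θ, hθ⟩ : ∃ θ, θ = min (δ / 4) (ε / 8) := ⟨_, rfl⟩
  have hθ0 : 0 < θ := by
    rw [hθ]
    exact lt_min (by linarith) (by linarith)
  have hθδ : θ ≤ δ / 4 := hθ ▸ min_le_left _ _
  have hθε : θ ≤ ε / 8 := hθ ▸ min_le_right _ _
  obtain ⟨y, hy1, hy2⟩ := exists_coe_approx x hx hθ0 (by linarith)
  choose v hv1 hv2 using fun n => exists_coe_approx (u n) (hu n) hθ0 (by linarith)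
  obtain ⟨p, q, hpq, h⟩ := hδ y hy1 v hv1 fun m n hmn => by
    have h1 := hs m n hmn
    have h2 : u m - u n = ((v m - v n : C00) : UniformSpace.Completion C00)
        - ((v m : UniformSpace.Completion C00) - u m) + (v n - u n) := by
      rw [UniformSpace.Completion.coe_sub]
      abel
    rw [← UniformSpace.Completion.norm_coe]
    rw [h2] at h1
    linarith [norm_add_le (((v m - v n : C00) : UniformSpace.Completion C00)
        - ((v m : UniformSpace.Completion C00) - u m)) (v n - u n),
      norm_sub_le ((v m - v n : C00) : UniformSpace.Completion C00)
        ((v m : UniformSpace.Completion C00) - u m), hv2 m, hv2 n]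
  refine ⟨p, q, hpq, ?_⟩
  have h2 : x + u p + u q = ((y + v p + v q : C00) : UniformSpace.Completion C00)
      - ((y : UniformSpace.Completion C00) - x) - (v p - u p) - (v q - u q) := by
    rw [UniformSpace.Completion.coe_add, UniformSpace.Completion.coe_add]
    abel
  rw [← UniformSpace.Completion.norm_coe] at h
  rw [h2, div_le_iff₀ three_pos]
  refine (norm_sub_le _ _).trans ?_
  refine (add_le_add ((norm_sub_le _ _).trans (add_le_add (norm_sub_le _ _) le_rfl)) le_rfl).trans ?_
  linarith [hv2 p, hv2 q]

end C00

end ResidueSpace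

/-- There is a separable Banach space `Z` which is `2`-β but admits no equivalent
`2`-NUC norm (hence is not isomorphic to any `2`-NUC Banach space). -/
theorem exists_two_beta_space_with_no_equivalent_two_NUC_norm :
    ∃ (Z : Type) (_ : NormedAddCommGroup Z) (_ : NormedSpace ℝ Z),
      CompleteSpace Z ∧ TopologicalSpace.SeparableSpace Z ∧
      (∀ ε : ℝ, 0 < ε → ∃ δ : ℝ, 0 < δ ∧ δ < 1 ∧
        ∀ x : Z, ‖x‖ ≤ 1 → ∀ u : ℕ → Z, (∀ n, ‖u n‖ ≤ 1) → Separated ε u →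
          ∃ n₁ n₂ : ℕ, n₁ < n₂ ∧ ‖x + u n₁ + u n₂‖ / 3 ≤ 1 - δ) ∧
      (∀ N : Z → ℝ, IsNormF N →
        (∃ c C : ℝ, 0 < c ∧ 0 < C ∧ ∀ x : Z, c * ‖x‖ ≤ N x ∧ N x ≤ C * ‖x‖) →
        ¬ TwoNUCWith N) := by
  refine ⟨UniformSpace.Completion ResidueSpace.C00, inferInstance, inferInstance, inferInstance,
    inferInstance, fun ε hε => ResidueSpace.C00.completion_two_beta hε, ?_⟩
  rintro N ⟨hN1, hN2, hN3⟩ ⟨c, C, hc, hC, hcC⟩ hNUC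
  refine ResidueSpace.C00.not_twoNUCWith
    (N := fun x => N (x : UniformSpace.Completion ResidueSpace.C00)) ⟨?_, ?_, ?_⟩ hc hC ?_ ?_
  · intro x y
    dsimp only
    rw [UniformSpace.Completion.coe_add]
    exact hN1 _ _
  · intro a x
    dsimp only
    rw [UniformSpace.Completion.coe_smul]
    exact hN2 _ _
  · intro x hx
    exact UniformSpace.Completion.coe_eq_zero_iff.1 (hN3 _ hx)
  · intro x
    rw [← UniformSpace.Completion.norm_coe]
    exact hcC _
  · intro ε hε
    obtain ⟨δ, h0, h1, h⟩ := hNUC ε hε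
    refine ⟨δ, h0, h1, fun u hu hs => ?_⟩
    obtain ⟨p, q, hpq, hle⟩ := h (fun n => (u n : UniformSpace.Completion ResidueSpace.C00)) hu
      fun m n hmn => by
        rw [← UniformSpace.Completion.coe_sub]
        exact hs m n hmn
    refine ⟨p, q, hpq, ?_⟩
    dsimp only
    rwa [UniformSpace.Completion.coe_add]
end

section
/- There exists a separable Banach space Z which is 2-NUC but for which there is no equivalent norm making Z 1-β; in particular, Z is not isomorphic to any 1-β Banach space. -/
open scoped BigOperators

section

open Filter Topology

lemma sqrt_sq_add_sq_le {a b : ℝ} (ha : 0 ≤ a) (hb : 0 ≤ b) :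
    Real.sqrt (a ^ 2 + b ^ 2) ≤ a + b :=
  Real.sqrt_le_iff.2 ⟨by positivity, by nlinarith [mul_nonneg ha hb]⟩

lemma sqrt_two_mul_sqrt_sq_add_sq_le {a b : ℝ} (ha : 0 ≤ a) (hb : 0 ≤ b) :
    Real.sqrt 2 * Real.sqrt (a ^ 2 + b ^ 2) ≤ a + b + |a - b| := by
  rw [← Real.sqrt_mul (by norm_num)]
  refine Real.sqrt_le_iff.2 ⟨by positivity, ?_⟩
  nlinarith [mul_nonneg (add_nonneg ha hb) (abs_nonneg (a - b)), sq_abs (a - b)]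

/-- Two nonnegative vectors in the unit ball of `ℓ¹` that are close to each other behave as if
they were `ℓ²`-orthogonal, with respect to the pointwise Euclidean combination. -/
lemma sq_sum_sqrt_le_add_dist {ι : Type*} [Fintype ι] {a b : ι → ℝ} (ha : ∀ i, 0 ≤ a i)
    (hb : ∀ i, 0 ≤ b i) (hA : ∑ i, a i ≤ 1) (hB : ∑ i, b i ≤ 1) :
    (∑ i, Real.sqrt (a i ^ 2 + b i ^ 2)) ^ 2 ≤
      (∑ i, a i) ^ 2 + (∑ i, b i) ^ 2 + 3 * ∑ i, |a i - b i| := by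
  have hA0 : 0 ≤ ∑ i, a i := Finset.sum_nonneg fun i _ => ha i
  have hB0 : 0 ≤ ∑ i, b i := Finset.sum_nonneg fun i _ => hb i
  have hD0 : 0 ≤ ∑ i, |a i - b i| := Finset.sum_nonneg fun i _ => abs_nonneg _
  have hQ0 : 0 ≤ ∑ i, Real.sqrt (a i ^ 2 + b i ^ 2) :=
    Finset.sum_nonneg fun i _ => Real.sqrt_nonneg _
  have hD : ∑ i, |a i - b i| ≤ ∑ i, a i + ∑ i, b i := by
    rw [← Finset.sum_add_distrib]
    exact Finset.sum_le_sum fun i _ => abs_le.2 ⟨by linarith [ha i, hb i], by linarith [ha i, hb i]⟩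
  have hQ : Real.sqrt 2 * ∑ i, Real.sqrt (a i ^ 2 + b i ^ 2) ≤
      ∑ i, a i + ∑ i, b i + ∑ i, |a i - b i| := by
    rw [Finset.mul_sum, ← Finset.sum_add_distrib, ← Finset.sum_add_distrib]
    exact Finset.sum_le_sum fun i _ => sqrt_two_mul_sqrt_sq_add_sq_le (ha i) (hb i)
  have h2 := pow_le_pow_left₀ (by positivity) hQ 2
  rw [mul_pow, Real.sq_sqrt (by norm_num)] at h2
  nlinarith [sq_nonneg (∑ i, a i - ∑ i, b i)]

/-- Minkowski's inequality for the mixed norm `ℓ¹(ℓ²)` with inner dimension two. -/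
lemma sq_sum_add_sq_sum_le {ι : Type*} [Fintype ι] (s d : ι → ℝ) :
    (∑ i, s i) ^ 2 + (∑ i, d i) ^ 2 ≤ (∑ i, Real.sqrt (s i ^ 2 + d i ^ 2)) ^ 2 := by
  have h := norm_sum_le Finset.univ fun i => (⟨s i, d i⟩ : ℂ)
  have h2 := pow_le_pow_left₀ (norm_nonneg _) h 2
  simp only [Complex.norm_def, Complex.normSq_apply] at h2
  rw [Real.sq_sqrt (add_nonneg (mul_self_nonneg _) (mul_self_nonneg _))] at h2
  simpa only [Complex.re_sum, Complex.im_sum, ← sq] using h2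

lemma sq_norm_add_add_sq_norm_sub_le {ι : Type*} [Fintype ι] {H : Type*} [NormedAddCommGroup H]
    [InnerProductSpace ℝ H] (u v : PiLp 1 fun _ : ι => H) :
    ‖u + v‖ ^ 2 + ‖u - v‖ ^ 2 ≤ 2 * (∑ i, Real.sqrt (‖u i‖ ^ 2 + ‖v i‖ ^ 2)) ^ 2 := by
  rw [PiLp.norm_eq_of_L1, PiLp.norm_eq_of_L1]
  refine (sq_sum_add_sq_sum_le _ _).trans_eq ?_
  have h : ∀ i, Real.sqrt (‖(u + v) i‖ ^ 2 + ‖(u - v) i‖ ^ 2) =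
      Real.sqrt 2 * Real.sqrt (‖u i‖ ^ 2 + ‖v i‖ ^ 2) := fun i => by
    rw [← Real.sqrt_mul (by norm_num)]
    congr 1
    have := parallelogram_law_with_norm ℝ (u i) (v i)
    simp only [PiLp.add_apply, PiLp.sub_apply]
    linarith
  simp only [h]
  rw [← Finset.mul_sum, mul_pow, Real.sq_sqrt (by norm_num)]

lemma exists_forall_sum_Ico_le {f : ℕ → ℝ} (hf : ∀ n, 0 ≤ f n) {C : ℝ}
    (hC : ∀ R, ∑ n ∈ Finset.range R, f n ≤ C) {t : ℝ} (ht : 0 < t) :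
    ∃ M, ∀ R, ∑ n ∈ Finset.Ico M R, f n ≤ t := by
  have hs : Summable f := summable_of_sum_range_le hf hC
  obtain ⟨M, hM⟩ := (hs.hasSum.tendsto_sum_nat.eventually
    (lt_mem_nhds (sub_lt_self (∑' n, f n) ht))).exists
  refine ⟨M, fun R => ?_⟩
  rcases le_total M R with h | h
  · rw [Finset.sum_Ico_eq_sub _ h]
    linarith [hs.sum_le_tsum (Finset.range R) fun n _ => hf n]
  · rw [Finset.Ico_eq_empty_of_le h]
    simpa using ht.le

/-- In the unit ball of the positive cone of `ℓ²(ℓ¹ⁿ)`, every sequence has two terms whose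
pointwise Euclidean combination has squared norm almost at most `2`. -/
lemma exists_lt_sum_sq_sum_sqrt_le {w : ℕ → (n : ℕ) → Fin n → ℝ} (hw : ∀ k n i, 0 ≤ w k n i)
    (hS : ∀ k R, ∑ n ∈ Finset.range R, (∑ i, w k n i) ^ 2 ≤ 1) {t : ℝ} (ht : 0 < t) :
    ∃ k l, k < l ∧ ∀ R, ∑ n ∈ Finset.range R,
      (∑ i, Real.sqrt (w k n i ^ 2 + w l n i ^ 2)) ^ 2 ≤ 2 + 7 * t := by
  have hA0 : ∀ k n, 0 ≤ ∑ i, w k n i := fun k n => Finset.sum_nonneg fun i _ => hw k n i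
  have hA1 : ∀ k n, ∑ i, w k n i ≤ 1 := fun k n => by
    have := (Finset.single_le_sum (f := fun n => (∑ i, w k n i) ^ 2) (fun _ _ => sq_nonneg _)
      (Finset.mem_range.2 n.lt_succ_self)).trans (hS k (n + 1))
    exact (sq_le_one_iff₀ (hA0 k n)).1 this
  obtain ⟨W, -, φ, hφ, hlim⟩ := (isCompact_univ_pi fun n : ℕ => isCompact_univ_pi fun _ : Fin n =>
    isCompact_Icc (a := (0 : ℝ)) (b := 1)).tendsto_subseq (x := w) fun k n _ i _ =>
      ⟨hw k n i, (Finset.single_le_sum (fun i _ => hw k n i) (Finset.mem_univ i)).trans (hA1 k n)⟩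
  have hcoord : ∀ n i, Tendsto (fun k => w (φ k) n i) atTop (𝓝 (W n i)) := fun n i =>
    tendsto_pi_nhds.1 (tendsto_pi_nhds.1 hlim n) i
  have hsq : ∀ s : Finset ℕ, Tendsto (fun k => ∑ n ∈ s, (∑ i, w (φ k) n i) ^ 2) atTop
      (𝓝 (∑ n ∈ s, (∑ i, W n i) ^ 2)) := fun s =>
    tendsto_finsetSum _ fun n _ => (tendsto_finsetSum _ fun i _ => hcoord n i).pow 2
  obtain ⟨M, hM⟩ := exists_forall_sum_Ico_le (f := fun n => (∑ i, W n i) ^ 2)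
    (fun n => sq_nonneg _) (fun R => le_of_tendsto' (hsq _) fun k => hS (φ k) R)
    (half_pos (sq_pos_of_pos ht))
  have hdist : ∀ᶠ k in atTop, ∑ n ∈ Finset.range M, ∑ i, |w (φ k) n i - W n i| < t / 2 := by
    have : Tendsto (fun k => ∑ n ∈ Finset.range M, ∑ i, |w (φ k) n i - W n i|) atTop
        (𝓝 (∑ n ∈ Finset.range M, ∑ i, |W n i - W n i|)) :=
      tendsto_finsetSum _ fun n _ => tendsto_finsetSum _ fun i _ =>
        ((hcoord n i).sub tendsto_const_nhds).abs
    refine this.eventually (gt_mem_nhds ?_)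
    simpa using ht
  obtain ⟨k, hk⟩ := hdist.exists
  obtain ⟨M', hM'⟩ := exists_forall_sum_Ico_le (f := fun n => (∑ i, w (φ k) n i) ^ 2)
    (fun n => sq_nonneg _) (hS (φ k)) (sq_pos_of_pos ht)
  have hmid : ∀ᶠ l in atTop, ∑ n ∈ Finset.Ico M M', (∑ i, w (φ l) n i) ^ 2 < t ^ 2 :=
    (hsq _).eventually (gt_mem_nhds ((hM M').trans_lt (half_lt_self (sq_pos_of_pos ht))))
  obtain ⟨l, hl, hl', hkl⟩ := (hdist.and (hmid.and (eventually_gt_atTop k))).exists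
  refine ⟨φ k, φ l, hφ hkl, fun R => ?_⟩
  set a := w (φ k) with ha
  set b := w (φ l) with hb
  have hpt : ∀ n, (∑ i, Real.sqrt (a n i ^ 2 + b n i ^ 2)) ^ 2 ≤
      (1 + t) * (∑ i, a n i) ^ 2 + (1 + t) * (∑ i, b n i) ^ 2
      + (if n < M then 3 * ∑ i, |a n i - b n i| else 0)
      + (if M ≤ n ∧ n < M' then (∑ i, b n i) ^ 2 / t else 0)
      + (if M' ≤ n then (∑ i, a n i) ^ 2 / t else 0) := fun n => by
    have hAn : 0 ≤ ∑ i, a n i := hA0 _ n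
    have hBn : 0 ≤ ∑ i, b n i := hA0 _ n
    have hQ0 : 0 ≤ ∑ i, Real.sqrt (a n i ^ 2 + b n i ^ 2) :=
      Finset.sum_nonneg fun i _ => Real.sqrt_nonneg _
    have hD0 : 0 ≤ ∑ i, |a n i - b n i| := Finset.sum_nonneg fun i _ => abs_nonneg _
    have hQ : ∑ i, Real.sqrt (a n i ^ 2 + b n i ^ 2) ≤ ∑ i, a n i + ∑ i, b n i := by
      rw [← Finset.sum_add_distrib]
      exact Finset.sum_le_sum fun i _ => sqrt_sq_add_sq_le (hw _ n i) (hw _ n i)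
    have hQ2 := pow_le_pow_left₀ hQ0 hQ 2
    have hclose := sq_sum_sqrt_le_add_dist (hw (φ k) n) (hw (φ l) n) (hA1 _ n) (hA1 _ n)
    rw [← ha, ← hb] at hclose
    set A := ∑ i, a n i
    set B := ∑ i, b n i
    have hyoung : ∀ x y : ℝ, 2 * x * y ≤ t * x ^ 2 + y ^ 2 / t := fun x y => by
      have : t * x ^ 2 + y ^ 2 / t - 2 * x * y = (t * x - y) ^ 2 / t := by field_simp; ring
      have : 0 ≤ (t * x - y) ^ 2 / t := by positivity
      linarith
    have h1 := hyoung A B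
    have h2 := hyoung B A
    have e1 : 0 ≤ t * A ^ 2 := by positivity
    have e2 : 0 ≤ t * B ^ 2 := by positivity
    have e3 : 0 ≤ A ^ 2 / t := by positivity
    have e4 : 0 ≤ B ^ 2 / t := by positivity
    split_ifs <;> first | nlinarith | (exfalso; omega)
  have hD : ∑ n ∈ Finset.range R, (if n < M then 3 * ∑ i, |a n i - b n i| else 0) ≤ 3 * t := by
    have htri : ∑ n ∈ Finset.range M, ∑ i, |a n i - b n i| ≤ t := by
      have : ∑ n ∈ Finset.range M, ∑ i, |a n i - b n i| ≤
          ∑ n ∈ Finset.range M, ∑ i, |a n i - W n i| +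
          ∑ n ∈ Finset.range M, ∑ i, |b n i - W n i| := by
        simp only [← Finset.sum_add_distrib]
        refine Finset.sum_le_sum fun n _ => Finset.sum_le_sum fun i _ => ?_
        rw [abs_sub_comm (b n i)]
        exact abs_sub_le _ _ _
      linarith
    rw [← Finset.sum_filter]
    calc _ ≤ ∑ n ∈ Finset.range M, 3 * ∑ i, |a n i - b n i| :=
          Finset.sum_le_sum_of_subset_of_nonneg (fun n hn => by simp at hn ⊢; omega)
            fun n _ _ => mul_nonneg (by norm_num) (Finset.sum_nonneg fun i _ => abs_nonneg _)
      _ ≤ 3 * t := by rw [← Finset.mul_sum]; linarith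
  have hdiv : ∀ x : ℝ, x ≤ t ^ 2 → x / t ≤ t := fun x hx => by
    rw [div_le_iff₀ ht]; nlinarith
  have hB : ∑ n ∈ Finset.range R, (if M ≤ n ∧ n < M' then (∑ i, b n i) ^ 2 / t else 0) ≤ t := by
    rw [← Finset.sum_filter]
    calc _ ≤ ∑ n ∈ Finset.Ico M M', (∑ i, b n i) ^ 2 / t :=
          Finset.sum_le_sum_of_subset_of_nonneg (fun n hn => by simp at hn ⊢; omega)
            fun n _ _ => by positivity
      _ ≤ t := by rw [← Finset.sum_div]; exact hdiv _ hl'.le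
  have hA : ∑ n ∈ Finset.range R, (if M' ≤ n then (∑ i, a n i) ^ 2 / t else 0) ≤ t := by
    rw [← Finset.sum_filter]
    calc _ ≤ ∑ n ∈ Finset.Ico M' R, (∑ i, a n i) ^ 2 / t :=
          Finset.sum_le_sum_of_subset_of_nonneg (fun n hn => by simp at hn ⊢; omega)
            fun n _ _ => by positivity
      _ ≤ t := by rw [← Finset.sum_div]; exact hdiv _ (hM' R)
  have hsum := Finset.sum_le_sum fun n (_ : n ∈ Finset.range R) => hpt n
  simp only [Finset.sum_add_distrib, ← Finset.mul_sum] at hsum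
  have hak := hS (φ k) R
  have hbl := hS (φ l) R
  rw [← ha] at hak
  rw [← hb] at hbl
  nlinarith

/-- The Hilbert space `ℓ²`. -/
abbrev SeqHilbert : Type := lp (fun _ : ℕ => ℝ) 2

/-- The `ℓ¹`-sum of `n` copies of `ℓ²`. -/
abbrev L1Block (n : ℕ) : Type := PiLp 1 fun _ : Fin n => SeqHilbert

/-- The `ℓ²`-sum of the spaces `ℓ¹ⁿ(ℓ²)`, `n ∈ ℕ`. -/
abbrev BlockSum : Type := lp L1Block 2

lemma separableSpace_lp_two {E : ℕ → Type} [∀ n, NormedAddCommGroup (E n)]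
    [∀ n, NormedSpace ℝ (E n)] [∀ n, TopologicalSpace.SeparableSpace (E n)] :
    TopologicalSpace.SeparableSpace (lp E 2) := by
  have hsep : TopologicalSpace.IsSeparable
      (⋃ n, Set.range fun x : E n => (lp.single 2 n x : lp E 2)) :=
    TopologicalSpace.IsSeparable.iUnion fun n =>
      TopologicalSpace.isSeparable_range (lp.isometry_single n).continuous
  rw [← TopologicalSpace.isSeparable_univ_iff]
  refine ((hsep.span (R := ℝ)).closure).mono fun f _ => ?_
  refine mem_closure_of_tendsto (lp.hasSum_single (by norm_num) f) (Eventually.of_forall fun s => ?_)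
  exact Submodule.sum_mem _ fun n _ => Submodule.subset_span (Set.mem_iUnion.2 ⟨n, f n, rfl⟩)

lemma separableSpace_blockSum : TopologicalSpace.SeparableSpace BlockSum := by
  have : TopologicalSpace.SeparableSpace SeqHilbert := separableSpace_lp_two
  have : ∀ n, TopologicalSpace.SeparableSpace (L1Block n) := fun n =>
    (PiLp.homeomorph 1 fun _ : Fin n => SeqHilbert).symm.surjective.denseRange.separableSpace
      (PiLp.homeomorph 1 fun _ : Fin n => SeqHilbert).symm.continuous
  exact separableSpace_lp_two

lemma hasSum_sq_norm (x : BlockSum) : HasSum (fun n => ‖x n‖ ^ 2) (‖x‖ ^ 2) := by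
  simpa using lp.hasSum_norm (p := 2) (by norm_num) x

lemma exists_lt_sq_norm_add_le {u : ℕ → BlockSum} (hu : ∀ n, ‖u n‖ ≤ 1) {t : ℝ} (ht : 0 < t) :
    ∃ k l, k < l ∧ ‖u k + u l‖ ^ 2 + ‖u k - u l‖ ^ 2 ≤ 4 + t := by
  obtain ⟨k, l, hkl, h⟩ := exists_lt_sum_sq_sum_sqrt_le (w := fun k n i => ‖u k n i‖)
    (fun _ _ _ => norm_nonneg _) (fun k R => by
      simp only [← PiLp.norm_eq_of_L1]
      exact ((hasSum_sq_norm (u k)).summable.sum_le_tsum _ fun _ _ => sq_nonneg _).trans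
        ((hasSum_sq_norm (u k)).tsum_eq.trans_le (pow_le_one₀ (norm_nonneg _) (hu k))))
    (t := t / 14) (by positivity)
  refine ⟨k, l, hkl, le_of_tendsto' ((hasSum_sq_norm (u k + u l)).add
    (hasSum_sq_norm (u k - u l))).tendsto_sum_nat fun R => ?_⟩
  have := Finset.sum_le_sum fun n (_ : n ∈ Finset.range R) =>
    sq_norm_add_add_sq_norm_sub_le (u k n) (u l n)
  rw [← Finset.mul_sum] at this
  refine this.trans ?_
  linarith [h R]

lemma blockSum_two_NUC {ε : ℝ} (hε : 0 < ε) : ∃ δ : ℝ, 0 < δ ∧ δ < 1 ∧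
    ∀ u : ℕ → BlockSum, (∀ n, ‖u n‖ ≤ 1) → Separated ε u →
      ∃ n₁ n₂ : ℕ, n₁ < n₂ ∧ ‖u n₁ + u n₂‖ / 2 ≤ 1 - δ := by
  refine ⟨min (1 / 2) (ε ^ 2 / 16), by positivity, by
    linarith [min_le_left (1 / 2) (ε ^ 2 / 16)], fun u hu hs => ?_⟩
  obtain ⟨k, l, hkl, h⟩ := exists_lt_sq_norm_add_le hu (t := ε ^ 2 / 2) (by positivity)
  refine ⟨k, l, hkl, ?_⟩
  have h1 := pow_le_pow_left₀ hε.le (hs k l hkl.ne) 2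
  have h2 := min_le_left (1 / 2) (ε ^ 2 / 16)
  have h3 := min_le_right (1 / 2) (ε ^ 2 / 16)
  set δ := min (1 / 2) (ε ^ 2 / 16)
  have : ‖u k + u l‖ ≤ 2 * (1 - δ) := abs_le_of_sq_le_sq' (by nlinarith) (by linarith) |>.2
  linarith

/-- The vector of `BlockSum` supported on the `n`-th block, with the `kᵢ`-th basis vector of `ℓ²`
in the `i`-th coordinate for `i ∈ I`. -/
noncomputable def blockVec {n : ℕ} (I : Finset (Fin n)) (k : Fin n → ℕ) : BlockSum :=
  lp.single 2 n (WithLp.toLp 1 fun i => if i ∈ I then lp.single 2 (k i) (1 : ℝ) else 0)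

lemma norm_blockVec {n : ℕ} (I : Finset (Fin n)) (k : Fin n → ℕ) :
    ‖blockVec I k‖ = I.card := by
  rw [blockVec, lp.norm_single (by norm_num), PiLp.norm_eq_of_L1]
  simp [apply_ite norm, lp.norm_single]

lemma card_le_norm_blockVec_sub {n : ℕ} (I : Finset (Fin n)) {k k' : Fin n → ℕ}
    (h : ∀ i, k i ≠ k' i) : (I.card : ℝ) ≤ ‖blockVec I k - blockVec I k'‖ := by
  rw [blockVec, blockVec, ← lp.single_sub, lp.norm_single (by norm_num), PiLp.norm_eq_of_L1]
  have : ∀ i, (if i ∈ I then (1 : ℝ) else 0) ≤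
      ‖(if i ∈ I then lp.single 2 (k i) (1 : ℝ) else 0 : SeqHilbert) -
        (if i ∈ I then lp.single 2 (k' i) (1 : ℝ) else 0)‖ := fun i => by
    split_ifs
    · refine le_trans ?_ (lp.norm_apply_le_norm (by norm_num) _ (k i))
      simp [h i]
    · exact norm_nonneg _
  refine le_trans (by simp) (Finset.sum_le_sum fun i (_ : i ∈ Finset.univ) => this i)

lemma blockVec_add {n : ℕ} {I J : Finset (Fin n)} (hIJ : Disjoint I J) (k k' : Fin n → ℕ) :
    blockVec I k + blockVec J k' = blockVec (I ∪ J) fun i => if i ∈ I then k i else k' i := by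
  rw [blockVec, blockVec, blockVec, ← lp.single_add, ← WithLp.toLp_add]
  congr 2
  ext1 i
  have : i ∈ I → i ∉ J := fun h => Finset.disjoint_left.1 hIJ h
  by_cases hI : i ∈ I <;> by_cases hJ : i ∈ J <;> simp_all

lemma exists_strictMono_coord {n : ℕ} {P : (Fin n → ℕ) → Prop}
    (hP : ∀ M, ∃ k, (∀ i, M ≤ k i) ∧ P k) (M : ℕ) :
    ∃ K : ℕ → Fin n → ℕ, (∀ m, P (K m)) ∧ (∀ m i, M ≤ K m i) ∧
      ∀ i, StrictMono fun m => K m i := by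
  choose g hg hPg using hP
  let K : ℕ → Fin n → ℕ := fun m => Nat.rec (g M) (fun _ k => g (M + ∑ i, k i + 1)) m
  have hK : ∀ m i, K m i < K (m + 1) i := fun m i => by
    have h1 : M + ∑ i, K m i + 1 ≤ K (m + 1) i := hg _ i
    have h2 := Finset.single_le_sum (fun i _ => Nat.zero_le (K m i)) (Finset.mem_univ i)
    omega
  refine ⟨K, fun m => ?_, fun m i => ?_, fun i => strictMono_nat_of_lt_succ fun m => hK m i⟩
  · cases m <;> exact hPg _
  · cases m with
    | zero => exact hg _ i
    | succ m => exact le_trans (by omega) (hg (M + ∑ i, K m i + 1) i)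

lemma exists_blockVec_norm_le {N : BlockSum → ℝ} (hN : IsNormF N) {c C δ : ℝ} (hc : 0 < c)
    (hC : 0 < C) (hcC : ∀ x, c * ‖x‖ ≤ N x ∧ N x ≤ C * ‖x‖) (hδ0 : 0 < δ) (hδ1 : δ < 1)
    (hδ : ∀ x, N x ≤ 1 → ∀ u : ℕ → BlockSum, (∀ n, N (u n) ≤ 1) → SeparatedWith N (c / C) u →
      ∃ n : ℕ, N (x + u n) / 2 ≤ 1 - δ) {n : ℕ} (j : ℕ) (I : Finset (Fin n))
    (hI : I.card = 2 ^ j) (M : ℕ) :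
    ∃ k : Fin n → ℕ, (∀ i, M ≤ k i) ∧ N (blockVec I k) ≤ C * (1 - δ) ^ j * 2 ^ j := by
  induction j generalizing I M with
  | zero =>
    refine ⟨fun _ => M, fun _ => le_rfl, (hcC _).2.trans_eq ?_⟩
    simp [norm_blockVec, hI]
  | succ j ih =>
    obtain ⟨I₁, hI₁, hcard₁⟩ := Finset.exists_subset_card_eq (s := I) (n := 2 ^ j)
      (by rw [hI]; exact Nat.pow_le_pow_right (by norm_num) j.le_succ)
    have hcard₂ : (I \ I₁).card = 2 ^ j := by
      rw [Finset.card_sdiff_of_subset hI₁, hI, hcard₁, pow_succ]; omega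
    obtain ⟨k, hkM, hk⟩ := ih I₁ hcard₁ M
    obtain ⟨K, hK, hKM, hmono⟩ := exists_strictMono_coord (ih (I \ I₁) hcard₂) M
    have hd : 0 < 1 - δ := by linarith
    have hd1 : (1 - δ) ^ j ≤ 1 := pow_le_one₀ hd.le (by linarith)
    set r := C * (1 - δ) ^ j * 2 ^ j with hr
    have hr0 : 0 < r := by positivity
    have hscale : ∀ x, N (r⁻¹ • x) = r⁻¹ * N x := fun x => by
      rw [hN.2.1, abs_of_pos (inv_pos.2 hr0)]
    have hball : ∀ x, N x ≤ r → N (r⁻¹ • x) ≤ 1 := fun x hx => by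
      rw [hscale, inv_mul_le_iff₀ hr0, mul_one]; exact hx
    obtain ⟨m, hm⟩ := hδ (r⁻¹ • blockVec I₁ k) (hball _ hk)
      (fun m => r⁻¹ • blockVec (I \ I₁) (K m)) (fun m => hball _ (hK m)) fun m m' hmm' => by
        rw [← smul_sub, hscale, inv_mul_eq_div, div_le_div_iff₀ hC hr0]
        have h1 := card_le_norm_blockVec_sub (I \ I₁) fun i => (hmono i).injective.ne hmm'
        rw [hcard₂] at h1
        push_cast at h1
        have h2 := (mul_le_mul_of_nonneg_left h1 hc.le).trans (hcC _).1
        have h3 : r ≤ C * 2 ^ j := by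
          rw [hr, mul_assoc]
          exact mul_le_mul_of_nonneg_left (mul_le_of_le_one_left (by positivity) hd1) hC.le
        nlinarith [mul_le_mul_of_nonneg_left h2 hC.le, mul_le_mul_of_nonneg_left h3 hc.le]
    refine ⟨fun i => if i ∈ I₁ then k i else K m i, fun i => ?_, ?_⟩
    · dsimp only
      split_ifs
      exacts [hkM i, hKM m i]
    · rw [← smul_add, hscale, blockVec_add Finset.disjoint_sdiff,
        Finset.union_sdiff_of_subset hI₁, div_le_iff₀ two_pos, inv_mul_le_iff₀ hr0] at hm
      refine hm.trans_eq ?_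
      rw [hr]; ring

lemma blockSum_not_oneBetaWith {N : BlockSum → ℝ} (hN : IsNormF N) {c C : ℝ} (hc : 0 < c)
    (hC : 0 < C) (hcC : ∀ x, c * ‖x‖ ≤ N x ∧ N x ≤ C * ‖x‖) : ¬ OneBetaWith N := fun hβ => by
  obtain ⟨δ, hδ0, hδ1, hδ⟩ := hβ (c / C) (by positivity)
  obtain ⟨j, hj⟩ := exists_pow_lt_of_lt_one (show 0 < c / C by positivity)
    (show 1 - δ < 1 by linarith)
  obtain ⟨k, -, hk⟩ := exists_blockVec_norm_le hN hc hC hcC hδ0 hδ1 hδ j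
    (Finset.univ : Finset (Fin (2 ^ j))) (by simp) 0
  have h := (hcC _).1.trans hk
  rw [norm_blockVec] at h
  simp only [Finset.card_univ, Fintype.card_fin] at h
  push_cast at h
  have h2 := le_of_mul_le_mul_right h (by positivity)
  rw [lt_div_iff₀ hC] at hj
  linarith

end

/-- There is a separable Banach space `Z` which is `2`-NUC but admits no equivalent
`1`-β norm (hence is not isomorphic to any `1`-β Banach space). -/
theorem exists_two_NUC_space_with_no_equivalent_one_beta_norm :
    ∃ (Z : Type) (_ : NormedAddCommGroup Z) (_ : NormedSpace ℝ Z),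
      CompleteSpace Z ∧ TopologicalSpace.SeparableSpace Z ∧
      (∀ ε : ℝ, 0 < ε → ∃ δ : ℝ, 0 < δ ∧ δ < 1 ∧
        ∀ u : ℕ → Z, (∀ n, ‖u n‖ ≤ 1) → Separated ε u →
          ∃ n₁ n₂ : ℕ, n₁ < n₂ ∧ ‖u n₁ + u n₂‖ / 2 ≤ 1 - δ) ∧
      (∀ N : Z → ℝ, IsNormF N →
        (∃ c C : ℝ, 0 < c ∧ 0 < C ∧ ∀ x : Z, c * ‖x‖ ≤ N x ∧ N x ≤ C * ‖x‖) →
        ¬ OneBetaWith N) := by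
  exact ⟨BlockSum, inferInstance, inferInstance, inferInstance, separableSpace_blockSum,
    fun _ hε => blockSum_two_NUC hε, fun _ hN ⟨_, _, hc, hC, hcC⟩ =>
      blockSum_not_oneBetaWith hN hc hC hcC⟩
end
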